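/- arXiv:2403.01574 — 2 statements merged into one kernel-verified Lean document; each statement's English description precedes it below -/
import Mathlib

section
/- Let H be a separable complex Hilbert space and let M be a von Neumann subalgebra of B(H), with ℓ : M → B(H) the inclusion map. If (M, ℓ) has the λ-Lindenstrauss–Pełczyński property for some λ ≥ 1, then there exist a compact Hausdorff space K and an isomorphism of Banach spaces (a continuous linear bijection with continuous inverse) from M onto C(K, ℂ), the space of continuous complex-valued functions on K with the supremum norm. -/
set_option synthInstance.maxHeartbeats 1000000
set_option maxHeartbeats 1000000

/-- `E` is an `L∞,λ`-space: `E` is infinite-dimensional and every finite-dimensional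
subspace is contained in a finite-dimensional subspace `G` that is `λ`-isomorphic to
`ℓ^∞(n)` (i.e. `Fin n → ℂ` with the sup norm), where `n = dim G`. -/
def IsLinftySpace (E : Type*) [NormedAddCommGroup E] [NormedSpace ℂ E] (lam : ℝ) : Prop :=
  (¬ FiniteDimensional ℂ E) ∧
  ∀ F : Subspace ℂ E, FiniteDimensional ℂ F →
    ∃ G : Subspace ℂ E, F ≤ G ∧ FiniteDimensional ℂ G ∧
      ∃ T : G ≃L[ℂ] (Fin (Module.finrank ℂ G) → ℂ),
        ‖(T : G →L[ℂ] (Fin (Module.finrank ℂ G) → ℂ))‖ *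
          ‖(T.symm : (Fin (Module.finrank ℂ G) → ℂ) →L[ℂ] G)‖ ≤ lam

/-- `(M, ℓ)` has the `λ`-Lindenstrauss–Pełczyński property: the map `ℓ` factors through
an `L∞,λ`-space by bounded linear operators. -/
def HasLPProperty {M Z : Type*} [NormedAddCommGroup M] [NormedSpace ℂ M]
    [NormedAddCommGroup Z] [NormedSpace ℂ Z] (lam : ℝ) (ℓ : M →L[ℂ] Z) : Prop :=
  ∃ (E : Type) (_ : NormedAddCommGroup E) (_ : NormedSpace ℂ E),
    IsLinftySpace E lam ∧ ∃ (S : M →L[ℂ] E) (T : E →L[ℂ] Z), T.comp S = ℓ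


/-- potential used for the greedy choice of signs -/
noncomputable def sgQ (t x s : ℝ) : ℝ := (3 * t ^ 2 * (x + s) - (x ^ 2 + 6 * x * s + 3 * s ^ 2)) / (2 * t ^ 3)

lemma sgQ_step (t : ℝ) (ht : 0 ≤ t) (z b : ℂ) (s : ℝ) :
    2 * sgQ t (‖z‖ ^ 2) (s + ‖b‖ ^ 2) ≤ sgQ t (‖z + b‖ ^ 2) s + sgQ t (‖z - b‖ ^ 2) s := by
  have h1 : ‖z + b‖ ^ 2 = ‖z‖ ^ 2 + ‖b‖ ^ 2 + 2 * (z * (starRingEnd ℂ) b).re := by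
    rw [← Complex.normSq_eq_norm_sq, ← Complex.normSq_eq_norm_sq, ← Complex.normSq_eq_norm_sq,
      Complex.normSq_add]
  have h2 : ‖z - b‖ ^ 2 = ‖z‖ ^ 2 + ‖b‖ ^ 2 - 2 * (z * (starRingEnd ℂ) b).re := by
    rw [← Complex.normSq_eq_norm_sq, ← Complex.normSq_eq_norm_sq, ← Complex.normSq_eq_norm_sq,
      Complex.normSq_sub]
  have h3 : (z * (starRingEnd ℂ) b).re ^ 2 ≤ ‖z‖ ^ 2 * ‖b‖ ^ 2 := by
    have := Complex.abs_re_le_norm (z * (starRingEnd ℂ) b)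
    rw [norm_mul, Complex.norm_conj] at this
    rw [← mul_pow, ← sq_abs]
    exact pow_le_pow_left₀ (abs_nonneg _) this 2
  rw [h1, h2]
  generalize (z * (starRingEnd ℂ) b).re = r at *
  have hz : 0 ≤ ‖z‖ ^ 2 := sq_nonneg _
  have hb : 0 ≤ ‖b‖ ^ 2 := sq_nonneg _
  generalize ‖z‖ ^ 2 = x at *
  generalize ‖b‖ ^ 2 = y at *
  unfold sgQ
  rw [← add_div, ← mul_div_assoc]
  apply div_le_div_of_nonneg_right _ (by positivity)
  nlinarith [sq_nonneg y]

lemma sg_exists {κ ι : Type*} [Fintype κ] [DecidableEq ι] (t : κ → ℝ) (ht : ∀ k, 0 ≤ t k)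
    (b : κ → ι → ℂ) (I : Finset ι) : ∀ z : κ → ℂ,
    ∃ ε : ι → ℂ, (∀ i, ‖ε i‖ = 1) ∧
      ∑ k, sgQ (t k) (‖z k‖ ^ 2) (∑ i ∈ I, ‖b k i‖ ^ 2) ≤
        ∑ k, sgQ (t k) (‖z k + ∑ i ∈ I, ε i * b k i‖ ^ 2) 0 := by
  induction I using Finset.induction_on with
  | empty => intro z; exact ⟨fun _ => 1, by simp, by simp⟩
  | insert j I hj ih =>
    intro z
    have key : ∑ k, 2 * sgQ (t k) (‖z k‖ ^ 2) (∑ i ∈ insert j I, ‖b k i‖ ^ 2) ≤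
        ∑ k, sgQ (t k) (‖z k + b k j‖ ^ 2) (∑ i ∈ I, ‖b k i‖ ^ 2) +
        ∑ k, sgQ (t k) (‖z k - b k j‖ ^ 2) (∑ i ∈ I, ‖b k i‖ ^ 2) := by
      rw [← Finset.sum_add_distrib]
      apply Finset.sum_le_sum
      intro k _
      rw [Finset.sum_insert hj, add_comm (‖b k j‖ ^ 2)]
      exact sgQ_step _ (ht k) _ _ _
    rw [← Finset.mul_sum] at key
    have aux : ∀ σ : ℂ, ‖σ‖ = 1 → 
        ∑ k, sgQ (t k) (‖z k‖ ^ 2) (∑ i ∈ insert j I, ‖b k i‖ ^ 2) ≤ 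
          ∑ k, sgQ (t k) (‖z k + σ * b k j‖ ^ 2) (∑ i ∈ I, ‖b k i‖ ^ 2) →
        ∃ ε : ι → ℂ, (∀ i, ‖ε i‖ = 1) ∧
      ∑ k, sgQ (t k) (‖z k‖ ^ 2) (∑ i ∈ insert j I, ‖b k i‖ ^ 2) ≤
        ∑ k, sgQ (t k) (‖z k + ∑ i ∈ insert j I, ε i * b k i‖ ^ 2) 0 := by
      intro σ hσ hle
      obtain ⟨ε, hε, h⟩ := ih (fun k => z k + σ * b k j)
      refine ⟨Function.update ε j σ, ?_, hle.trans (h.trans (le_of_eq ?_))⟩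
      · intro i
        by_cases hi : i = j
        · subst hi; simpa using hσ
        · simpa [Function.update_of_ne hi] using hε i
      · refine Finset.sum_congr rfl fun k _ => ?_
        rw [Finset.sum_insert hj, ← add_assoc, Function.update_self]
        congr 4
        refine Finset.sum_congr rfl fun i hi => ?_
        rw [Function.update_of_ne]
        rintro rfl; exact hj hi
    by_cases hc : ∑ k, sgQ (t k) (‖z k‖ ^ 2) (∑ i ∈ insert j I, ‖b k i‖ ^ 2) ≤ 
          ∑ k, sgQ (t k) (‖z k + b k j‖ ^ 2) (∑ i ∈ I, ‖b k i‖ ^ 2)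
    · exact aux 1 (by simp) (by simpa using hc)
    · refine aux (-1) (by simp) ?_
      simp only [neg_mul, one_mul, ← sub_eq_add_neg]
      linarith

lemma sgQ_le (t x : ℝ) (ht : 0 ≤ t) (hx : 0 ≤ x) : sgQ t (x ^ 2) 0 ≤ x := by
  unfold sgQ
  rcases ht.eq_or_lt with rfl | ht
  · simpa using hx
  · rw [div_le_iff₀ (by positivity)]
    nlinarith [mul_nonneg hx (mul_nonneg (sq_nonneg (x - t)) (by positivity : 0 ≤ x + 2 * t))]

lemma sgQ_ge (y : ℝ) (hy : 0 ≤ y) : y / 2 ≤ sgQ (2 * y) 0 (y ^ 2) := by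
  unfold sgQ
  rcases hy.eq_or_lt with rfl | hy
  · simp
  · rw [le_div_iff₀ (by positivity)]
    nlinarith [pow_pos hy 4]

lemma sg_main {κ ι : Type*} [Fintype κ] [Fintype ι] (b : κ → ι → ℂ) :
    ∃ ε : ι → ℂ, (∀ i, ‖ε i‖ = 1) ∧
      ∑ k, √(∑ i, ‖b k i‖ ^ 2) / 2 ≤ ∑ k, ‖∑ i, ε i * b k i‖ := by
  classical
  obtain ⟨ε, h1, h2⟩ := sg_exists (fun k => 2 * √(∑ i, ‖b k i‖ ^ 2)) (fun k => by positivity) b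
    Finset.univ 0
  refine ⟨ε, h1, ?_⟩
  calc _ ≤ _ := ?_
    _ ≤ _ := h2
    _ ≤ _ := ?_
  · refine Finset.sum_le_sum fun k _ => ?_
    have := sgQ_ge (√(∑ i, ‖b k i‖ ^ 2)) (by positivity)
    rw [Real.sq_sqrt (by positivity)] at this
    simpa using this
  · refine Finset.sum_le_sum fun k _ => ?_
    have := sgQ_le (2 * √(∑ i, ‖b k i‖ ^ 2)) (‖∑ i, ε i * b k i‖) (by positivity) (by positivity)
    simpa using this


lemma sum_norm_le_of_functional {m : ℕ} (ψ : (Fin m → ℂ) →ₗ[ℂ] ℂ) (C : ℝ) 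
    (h : ∀ x, ‖ψ x‖ ≤ C * ‖x‖) (hC : 0 ≤ C) : ∑ k, ‖ψ (Pi.single k 1)‖ ≤ C := by
  let θ : Fin m → ℂ := fun k => (starRingEnd ℂ) (ψ (Pi.single k 1)) / ‖ψ (Pi.single k 1)‖
  have h1 : ψ θ = ∑ k, (‖ψ (Pi.single k 1)‖ : ℂ) := by
    conv_lhs => rw [← Finset.univ_sum_single θ]
    rw [map_sum]
    refine Finset.sum_congr rfl fun k _ => ?_
    have : (Pi.single k (θ k) : Fin m → ℂ) = θ k • Pi.single k 1 := by
      rw [← Pi.single_smul]; simp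
    rw [this, map_smul, smul_eq_mul]
    simp only [θ]
    by_cases hz : ψ (Pi.single k 1) = 0
    · simp [hz]
    · have : (‖ψ (Pi.single k 1)‖ : ℂ) ≠ 0 := by simpa using hz
      field_simp
      rw [Complex.conj_mul']
  have h2 : ‖θ‖ ≤ 1 := by
    rw [pi_norm_le_iff_of_nonneg zero_le_one]
    intro k
    simp only [θ, norm_div, Complex.norm_conj, Complex.norm_real, norm_norm]
    exact div_self_le_one _
  have h3 := h θ
  rw [h1, ← Complex.ofReal_sum, Complex.norm_real, Real.norm_of_nonneg (by positivity)] at h3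
  nlinarith

lemma lp_bound {X E Y : Type*} [NormedAddCommGroup X] [NormedSpace ℂ X]
    [NormedAddCommGroup E] [NormedSpace ℂ E] [NormedAddCommGroup Y] [NormedSpace ℂ Y]
    {lam : ℝ} (hE : IsLinftySpace E lam) (S : X →L[ℂ] E) (T : E →L[ℂ] Y) {n : ℕ}
    (v : Fin n → X) (φ : Fin n → Y →ₗ[ℂ] ℂ)
    (hv : ∀ c : Fin n → ℂ, ‖∑ i, c i • v i‖ ≤ √(∑ i, ‖c i‖ ^ 2))
    (hφ : ∀ ε : Fin n → ℂ, (∀ i, ‖ε i‖ = 1) → ∀ y, ‖∑ i, ε i * φ i y‖ ≤ √n * ‖y‖)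
    (hφv : ∀ i, φ i (T (S (v i))) = 1) : √n ≤ 2 * (lam * ‖S‖ * ‖T‖) := by
  obtain ⟨-, hE⟩ := hE
  obtain ⟨G, hFG, hG, τ, hτ⟩ := hE (Submodule.span ℂ (Set.range fun i => S (v i)))
    (FiniteDimensional.span_of_finite ℂ (Set.finite_range _))
  generalize Module.finrank ℂ G = m at τ hτ
  have hm : ∀ i, S (v i) ∈ G := fun i => hFG (Submodule.subset_span ⟨i, rfl⟩)
  let g : Fin n → G := fun i => ⟨S (v i), hm i⟩
  let a : Fin m → Fin n → ℂ := fun k i => τ (g i) k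
  let b : Fin m → Fin n → ℂ := fun k i => φ i (T (τ.symm (Pi.single k 1)))
  set A := ‖(τ : G →L[ℂ] (Fin m → ℂ))‖
  set B := ‖(τ.symm : (Fin m → ℂ) →L[ℂ] G)‖
  have hA : 0 ≤ A := norm_nonneg (τ : G →L[ℂ] (Fin m → ℂ))
  have hB : 0 ≤ B := norm_nonneg (τ.symm : (Fin m → ℂ) →L[ℂ] G)
  have ha : ∀ k, √(∑ i, ‖a k i‖ ^ 2) ≤ A * ‖S‖ := by
    intro k
    set s := ∑ i, ‖a k i‖ ^ 2 with hs
    have hs0 : 0 ≤ s := by positivity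
    have e1 : (τ (∑ i, (starRingEnd ℂ) (a k i) • g i)) k = (s : ℂ) := by
      simp only [map_sum, map_smul, Finset.sum_apply, Pi.smul_apply, smul_eq_mul, hs]
      push_cast
      refine Finset.sum_congr rfl fun i _ => ?_
      exact Complex.conj_mul' _
    have e2 : ‖(∑ i, (starRingEnd ℂ) (a k i) • g i)‖ ≤ ‖S‖ * √s := by
      have : ((∑ i, (starRingEnd ℂ) (a k i) • g i : G) : E) =
          S (∑ i, (starRingEnd ℂ) (a k i) • v i) := by
        simp [map_sum, g]
      rw [Submodule.coe_norm, this]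
      refine (S.le_opNorm _).trans (mul_le_mul_of_nonneg_left ?_ (norm_nonneg _))
      refine (hv _).trans (le_of_eq ?_)
      simp [hs]
    have e3 : s ≤ A * (‖S‖ * √s) := by
      calc s = ‖(τ (∑ i, (starRingEnd ℂ) (a k i) • g i)) k‖ := by
            rw [e1, Complex.norm_real, Real.norm_of_nonneg hs0]
        _ ≤ ‖τ (∑ i, (starRingEnd ℂ) (a k i) • g i)‖ := norm_le_pi_norm _ k
        _ ≤ A * ‖(∑ i, (starRingEnd ℂ) (a k i) • g i)‖ :=
            (τ : G →L[ℂ] (Fin m → ℂ)).le_opNorm _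
        _ ≤ _ := mul_le_mul_of_nonneg_left e2 hA
    rcases hs0.eq_or_lt with h0 | h0
    · rw [← h0]; simp; positivity
    · have : 0 < √s := Real.sqrt_pos.2 h0
      have hss : √s * √s = s := Real.mul_self_sqrt hs0
      by_contra! hcon
      nlinarith
  obtain ⟨ε, hε, hsum⟩ := sg_main b
  have hb : ∑ k, ‖∑ i, ε i * b k i‖ ≤ √n * ‖T‖ * B := by
    let ψ : (Fin m → ℂ) →ₗ[ℂ] ℂ := ∑ i, ε i • (φ i ∘ₗ T.toLinearMap ∘ₗ G.subtype ∘ₗ τ.symm.toLinearEquiv.toLinearMap)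
    have hψ : ∀ x, ψ x = ∑ i, ε i * φ i (T (τ.symm x)) := by
      intro x; simp [ψ]
    have := sum_norm_le_of_functional ψ (√n * ‖T‖ * B) (fun x => ?_) (by positivity)
    · simpa only [hψ] using this
    · rw [hψ]
      refine (hφ ε hε _).trans ?_
      rw [mul_assoc, mul_assoc]
      refine mul_le_mul_of_nonneg_left ?_ (by positivity)
      refine (T.le_opNorm _).trans (mul_le_mul_of_nonneg_left ?_ (by positivity))
      exact (τ.symm : (Fin m → ℂ) →L[ℂ] G).le_opNorm x
  have hn : (n : ℂ) = ∑ k, ∑ i, a k i * b k i := by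
    rw [Finset.sum_comm]
    have : ∀ i, ∑ k, a k i * b k i = 1 := by
      intro i
      rw [← hφv i]
      have e : (S (v i)) = ((τ.symm (∑ k, a k i • Pi.single k 1) : G) : E) := by
        have : (∑ k, a k i • Pi.single k 1 : Fin m → ℂ) = τ (g i) := by
          conv_rhs => rw [← Finset.univ_sum_single (τ (g i))]
          refine Finset.sum_congr rfl fun k _ => ?_
          rw [← Pi.single_smul]; simp [a]
        rw [this]; simp [g]
      rw [e]
      simp [b, map_sum]
    simp [this]
  have hn2 : (n : ℝ) ≤ ∑ k, √(∑ i, ‖a k i‖ ^ 2) * √(∑ i, ‖b k i‖ ^ 2) := by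
    calc (n : ℝ) = ‖(n : ℂ)‖ := by simp
      _ ≤ ∑ k, ‖∑ i, a k i * b k i‖ := by rw [hn]; exact norm_sum_le _ _
      _ ≤ _ := by
        refine Finset.sum_le_sum fun k _ => ?_
        refine (norm_sum_le _ _).trans ?_
        simp only [norm_mul]
        exact Real.sum_mul_le_sqrt_mul_sqrt _ _ _
  have hn3 : (n : ℝ) ≤ A * ‖S‖ * (2 * (√n * ‖T‖ * B)) := by
    refine hn2.trans ?_
    calc _ ≤ ∑ k, A * ‖S‖ * √(∑ i, ‖b k i‖ ^ 2) :=
          Finset.sum_le_sum fun k _ => mul_le_mul_of_nonneg_right (ha k) (by positivity)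
      _ = A * ‖S‖ * (2 * ∑ k, √(∑ i, ‖b k i‖ ^ 2) / 2) := by
          rw [← Finset.mul_sum, ← Finset.sum_div]; ring
      _ ≤ _ := by
          refine mul_le_mul_of_nonneg_left ?_ (by positivity)
          linarith
  have hn4 : (n : ℝ) ≤ √n * (2 * (lam * ‖S‖ * ‖T‖)) := by
    refine hn3.trans ?_
    have : A * ‖S‖ * (2 * (√n * ‖T‖ * B)) = (A * B) * (2 * √n * ‖S‖ * ‖T‖) := by ring
    rw [this]
    refine (mul_le_mul_of_nonneg_right hτ (by positivity)).trans (le_of_eq (by ring))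
  have hlam : 0 ≤ lam := le_trans (by positivity) hτ
  rcases (Nat.cast_nonneg (α := ℝ) n).eq_or_lt with h0 | h0
  · rw [← h0]; simp; positivity
  · have : 0 < √(n : ℝ) := Real.sqrt_pos.2 h0
    have hss : √(n : ℝ) * √n = n := Real.mul_self_sqrt h0.le
    by_contra! hcon
    nlinarith


section
variable {H : Type*} [NormedAddCommGroup H] [InnerProductSpace ℂ H] [CompleteSpace H]

lemma proj_norm_le {e : H →L[ℂ] H} (he : IsStarProjection e) : ‖e‖ ≤ 1 := by
  have h : ‖e‖ * ‖e‖ = ‖e‖ := by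
    rw [← CStarRing.norm_star_mul_self, he.isSelfAdjoint.star_eq, he.isIdempotentElem.eq]
  by_contra! hc
  nlinarith

lemma col_norm {n : ℕ} {e : H →L[ℂ] H} (he : IsStarProjection e) (v : Fin n → H →L[ℂ] H)
    (hv : ∀ i j, star (v i) * v j = if i = j then e else 0) (c : Fin n → ℂ) :
    ‖∑ i, c i • v i‖ ≤ √(∑ i, ‖c i‖ ^ 2) := by
  apply Real.le_sqrt_of_sq_le
  rw [sq, ← CStarRing.norm_star_mul_self]
  have : star (∑ i, c i • v i) * (∑ i, c i • v i) = ((∑ i, ‖c i‖ ^ 2 : ℝ) : ℂ) • e := by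
    rw [star_sum, Finset.sum_mul_sum]
    simp only [star_smul, smul_mul_smul_comm, hv]
    push_cast
    rw [Finset.sum_smul]
    refine Finset.sum_congr rfl fun i _ => ?_
    simp
    rw [Complex.conj_mul']
  rw [this, norm_smul, Complex.norm_real, Real.norm_of_nonneg (by positivity)]
  exact mul_le_of_le_one_right (by positivity) (proj_norm_le he)

lemma col_bound {X E : Type*} [NormedAddCommGroup X] [NormedSpace ℂ X]
    [NormedAddCommGroup E] [NormedSpace ℂ E] 
    {lam : ℝ} (hE : IsLinftySpace E lam) (S : X →L[ℂ] E) (T : E →L[ℂ] (H →L[ℂ] H))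
    (j : X →ₗᵢ[ℂ] (H →L[ℂ] H)) (hj : ∀ x, T (S x) = j x) {n : ℕ}
    {e : H →L[ℂ] H} (he : IsStarProjection e) (he0 : e ≠ 0) (v : Fin n → H →L[ℂ] H)
    (hvX : ∀ i, ∃ x, j x = v i)
    (hv : ∀ i j, star (v i) * v j = if i = j then e else 0) : √n ≤ 2 * (lam * ‖S‖ * ‖T‖) := by
  choose x hx using hvX
  obtain ⟨ξ, hξ1, hξ⟩ : ∃ ξ : H, ‖ξ‖ = 1 ∧ e ξ = ξ := by
    obtain ⟨ζ, hζ⟩ : ∃ ζ, e ζ ≠ 0 := by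
      by_contra! hc; exact he0 (ContinuousLinearMap.ext hc)
    refine ⟨(‖e ζ‖⁻¹ : ℂ) • e ζ, ?_, ?_⟩
    · rw [norm_smul]; simp [hζ]
    · rw [map_smul]; congr 1
      exact congrArg (fun f : H →L[ℂ] H => f ζ) he.isIdempotentElem.eq
  refine lp_bound hE S T x (fun i => (innerₛₗ ℂ (v i ξ)) ∘ₗ 
    (ContinuousLinearMap.apply ℂ H ξ).toLinearMap) ?_ ?_ ?_
  · intro c
    rw [← j.norm_map, map_sum]
    simp only [map_smul, hx]
    exact col_norm he v hv c
  · intro ε hε y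
    have h1 : ∑ i, ε i * inner ℂ (v i ξ) (y ξ) = inner ℂ ((∑ i, star (ε i) • v i) ξ) (y ξ) := by
      simp only [ContinuousLinearMap.sum_apply, sum_inner, ContinuousLinearMap.smul_apply, inner_smul_left]
      simp
    have h2 := col_norm he v hv (fun i => star (ε i))
    simp only [norm_star, hε] at h2
    simp only [LinearMap.comp_apply, innerₛₗ_apply_apply]
    change ‖∑ i, ε i * inner ℂ (v i ξ) (y ξ)‖ ≤ _
    rw [h1]
    refine (norm_inner_le_norm _ _).trans ?_
    refine mul_le_mul ?_ ?_ (norm_nonneg _) (by positivity)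
    · refine (ContinuousLinearMap.le_opNorm _ _).trans ?_
      rw [hξ1, mul_one]
      simpa using h2
    · simpa [hξ1] using y.le_opNorm ξ
  · intro i
    change inner ℂ (v i ξ) ((T (S (x i))) ξ) = 1
    rw [hj, hx, ← ContinuousLinearMap.adjoint_inner_right]
    have := congrArg (fun f : H →L[ℂ] H => f ξ) (hv i i)
    simp at this
    change (ContinuousLinearMap.adjoint (v i)) ((v i) ξ) = e ξ at this
    rw [this, hξ, inner_self_eq_norm_sq_to_K, hξ1]; simp
end


section
variable {H : Type*} [NormedAddCommGroup H] [InnerProductSpace ℂ H] [CompleteSpace H]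

lemma vn_mem_iff {M : VonNeumannAlgebra H} {x : H →L[ℂ] H} :
    x ∈ M ↔ ∀ c ∈ M.commutant, c * x = x * c := by
  conv_lhs => rw [← M.commutant_commutant]
  rw [VonNeumannAlgebra.mem_commutant_iff]

lemma vn_comm {M : VonNeumannAlgebra H} {x c : H →L[ℂ] H} (hx : x ∈ M) (hc : c ∈ M.commutant) :
    c * x = x * c := vn_mem_iff.1 hx c hc

lemma vn_smul_mem {M : VonNeumannAlgebra H} {x : H →L[ℂ] H} (c : ℂ) (hx : x ∈ M) : c • x ∈ M :=
  M.toStarSubalgebra.smul_mem hx c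

lemma proj_kill (K : Submodule ℂ H) (a : H →L[ℂ] H) (ha : ∀ ξ ∈ K, a ξ = 0) :
    a * K.topologicalClosure.starProjection = 0 := by
  have h : K.topologicalClosure ≤ a.ker :=
    K.topologicalClosure_minimal (fun ξ hξ => ha ξ hξ) a.isClosed_ker
  ext ξ
  exact h (Submodule.starProjection_apply_mem _ ξ)

lemma vn_proj (M : VonNeumannAlgebra H) (K : Submodule ℂ H)
    (hK : ∀ c ∈ M.commutant, ∀ ξ ∈ K, c ξ ∈ K) :
    K.topologicalClosure.starProjection ∈ M := by
  have hP : IsStarProjection (K.topologicalClosure.starProjection) := isStarProjection_starProjection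
  rw [VonNeumannAlgebra.IsStarProjection.mem_iff hP]
  intro c hc
  rw [Submodule.range_starProjection, Module.End.mem_invtSubmodule]
  refine K.topologicalClosure_minimal (fun ξ hξ => K.le_topologicalClosure (hK c hc ξ hξ)) ?_
  exact K.isClosed_topologicalClosure.preimage c.continuous

lemma vn_rangeProj (M : VonNeumannAlgebra H) (K : Submodule ℂ H)
    (hK : ∀ c ∈ M.commutant, ∀ ξ ∈ K, c ξ ∈ K) :
    ∃ P ∈ M, IsStarProjection P ∧ (∀ ξ ∈ K, P ξ = ξ) ∧
      ∀ a : H →L[ℂ] H, (∀ ξ ∈ K, a ξ = 0) → a * P = 0 := by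
  refine ⟨_, vn_proj M K hK, isStarProjection_starProjection, fun ξ hξ => ?_, proj_kill K⟩
  exact Submodule.starProjection_eq_self_iff.2 (K.le_topologicalClosure hξ)

lemma vn_isom (M : VonNeumannAlgebra H) (W : Submodule ℂ (H × H))
    (hW : ∀ c ∈ M.commutant, ∀ w ∈ W, (c w.1, c w.2) ∈ W)
    (hn : ∀ w ∈ W, ‖w.1‖ = ‖w.2‖) :
    ∃ u ∈ M, u * star u * u = u ∧ (∀ w ∈ W, u w.1 = w.2) ∧ (∀ w ∈ W, (star u * u) w.1 = w.1) ∧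
      (∀ a : H →L[ℂ] H, (∀ w ∈ W, a w.1 = 0) → a * star u = 0) ∧
      (∀ a : H →L[ℂ] H, (∀ w ∈ W, a w.2 = 0) → a * u = 0) := by
  let K := W.map (LinearMap.fst ℂ H H)
  let D := K.topologicalClosure
  have hWD : ∀ w ∈ W, w.1 ∈ D := fun w hw => K.le_topologicalClosure ⟨w, hw, rfl⟩
  let e : W →ₗ[ℂ] D := LinearMap.codRestrict D ((LinearMap.fst ℂ H H).comp W.subtype)
    (fun w => hWD w w.2)
  let f : W →ₗ[ℂ] H := (LinearMap.snd ℂ H H).comp W.subtype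
  have he : ∀ w : W, ((e w : D) : H) = w.1.1 := fun w => rfl
  have hf : ∀ w : W, f w = w.1.2 := fun w => rfl
  have hd : DenseRange e := by
    intro d
    rw [Metric.mem_closure_iff]
    intro ε hε
    have : (d : H) ∈ closure (K : Set H) := by
      rw [← Submodule.topologicalClosure_coe]; exact d.2
    obtain ⟨b, hb, hdb⟩ := Metric.mem_closure_iff.1 this ε hε
    obtain ⟨w, hw, rfl⟩ := hb
    exact ⟨e ⟨w, hw⟩, ⟨_, rfl⟩, hdb⟩
  have hnorm : ∀ w, ‖f w‖ ≤ 1 * ‖e w‖ := by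
    intro w
    rw [one_mul, Submodule.coe_norm, he, hf, hn w w.2]
  let g : D →L[ℂ] H := f.extendOfNorm e
  have hg : ∀ w, g (e w) = f w := fun w => LinearMap.extendOfNorm_eq hd ⟨1, hnorm⟩ w
  have hgn : ∀ d, ‖g d‖ = ‖d‖ := by
    intro d
    refine hd.induction_on (p := fun d => ‖g d‖ = ‖d‖) d 
      (isClosed_eq (by fun_prop) (by fun_prop)) ?_
    intro w
    rw [hg, Submodule.coe_norm, he, hf, hn w w.2]
  let P := D.starProjection
  have hPM : P ∈ M := by
    apply vn_proj M K
    rintro c hc _ ⟨w, hw, rfl⟩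
    exact ⟨_, hW c hc w hw, rfl⟩
  let u : H →L[ℂ] H := g ∘L D.orthogonalProjectionOnto
  have hu : ∀ ξ, u ξ = g (D.orthogonalProjectionOnto ξ) := fun ξ => rfl
  have huw : ∀ w ∈ W, u w.1 = w.2 := by
    intro w hw
    have : D.orthogonalProjectionOnto w.1 = e ⟨w, hw⟩ :=
      Submodule.orthogonalProjectionOnto_mem_subspace_eq_self (K := D) (e ⟨w, hw⟩)
    rw [hu, this, hg, hf]
  have hPw : ∀ w ∈ W, P w.1 = w.1 := fun w hw => Submodule.starProjection_eq_self_iff.2 (hWD w hw)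
  have huP : u * P = u := by
    ext ξ
    change g (D.orthogonalProjectionOnto (D.orthogonalProjectionOnto ξ : H)) = _
    rw [Submodule.orthogonalProjectionOnto_mem_subspace_eq_self, hu]
  have huu : star u * u = P := by
    apply ContinuousLinearMap.coe_injective
    rw [← ext_inner_map]
    intro ξ
    change inner ℂ ((ContinuousLinearMap.adjoint u) (u ξ)) ξ = inner ℂ (P ξ) ξ
    rw [ContinuousLinearMap.adjoint_inner_left, inner_self_eq_norm_sq_to_K]
    have h1 : P ξ = P (P ξ) := 
      (congrArg (fun f : H →L[ℂ] H => f ξ) (D.isIdempotentElem_starProjection).eq).symm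
    rw [h1, Submodule.inner_starProjection_left_eq_right, inner_self_eq_norm_sq_to_K, hu, hgn,
      Submodule.coe_norm]
    rfl
  have hP : IsStarProjection P := isStarProjection_starProjection
  have hkill : ∀ a : H →L[ℂ] H, (∀ w ∈ W, a w.1 = 0) → a * P = 0 := by
    intro a ha
    apply proj_kill K
    rintro _ ⟨w, hw, rfl⟩
    exact ha w hw
  refine ⟨u, ?_, ?_, huw, ?_, ?_, ?_⟩
  · rw [vn_mem_iff]
    intro c hc
    have h1 : (c * u - u * c) * P = 0 := by
      apply hkill
      intro w hw
      change c (u w.1) - u (c w.1) = 0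
      rw [huw w hw, huw _ (hW c hc w hw), sub_self]
    have h2 := vn_comm hPM hc
    rw [sub_mul, mul_assoc, huP, mul_assoc, h2, ← mul_assoc, huP, sub_eq_zero] at h1
    exact h1
  · rw [mul_assoc, huu, huP]
  · intro w hw; rw [huu, hPw w hw]
  · intro a ha
    have h1 : P * star u = star u := by
      have := congrArg star huP
      rwa [star_mul, hP.isSelfAdjoint.star_eq] at this
    rw [← h1, ← mul_assoc, hkill a ha, zero_mul]
  · intro a ha
    ext ξ
    change a (g (D.orthogonalProjectionOnto ξ)) = 0
    refine hd.induction_on (p := fun d => a (g d) = 0) _ 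
      (isClosed_eq (by fun_prop) (by fun_prop)) ?_
    intro w
    rw [hg, hf, ha w w.2]

lemma norm_abs_apply (y : H →L[ℂ] H) (ξ : H) : ‖CFC.abs y ξ‖ = ‖y ξ‖ := by
  have hsa : star (CFC.abs y) = CFC.abs y := (IsSelfAdjoint.of_nonneg (CFC.abs_nonneg y)).star_eq
  have h : star (CFC.abs y) * CFC.abs y = star y * y := by rw [hsa, CFC.abs_mul_abs]
  have key : ∀ z : H →L[ℂ] H, ((‖z ξ‖ : ℂ)) ^ 2 = inner ℂ ((star z * z) ξ) ξ := by
    intro z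
    change _ = inner ℂ ((ContinuousLinearMap.adjoint z) (z ξ)) ξ
    rw [ContinuousLinearMap.adjoint_inner_left, inner_self_eq_norm_sq_to_K]; rfl
  have := (key (CFC.abs y)).trans ((congrArg (fun f : H →L[ℂ] H => inner ℂ (f ξ) ξ) h).trans (key y).symm)
  have h2 : ‖CFC.abs y ξ‖ ^ 2 = ‖y ξ‖ ^ 2 := by exact_mod_cast this
  exact (pow_left_inj₀ (norm_nonneg _) (norm_nonneg _) two_ne_zero).1 h2

lemma abs_mul_zero {y a : H →L[ℂ] H} (h : y * a = 0) : a.adjoint * CFC.abs y = 0 := by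
  have h1 : CFC.abs y * a = 0 := by
    ext ξ
    change CFC.abs y (a ξ) = 0
    rw [← norm_eq_zero]
    change ‖CFC.abs y (a ξ)‖ = 0
    rw [norm_abs_apply]
    change ‖(y * a) ξ‖ = 0
    rw [h]; simp
  have hsa : star (CFC.abs y) = CFC.abs y := (IsSelfAdjoint.of_nonneg (CFC.abs_nonneg y)).star_eq
  have := congrArg star h1
  rwa [star_mul, hsa, star_zero] at this

lemma vn_abs_comm {M : VonNeumannAlgebra H} {y c : H →L[ℂ] H} (hy : y ∈ M)
    (hc : c ∈ M.commutant) : c * CFC.abs y = CFC.abs y * c :=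
  (Commute.cfcAbs_left (a := y) (b := c) (vn_comm hy hc).symm (vn_comm hy (star_mem hc)).symm).symm

lemma vn_polar {M : VonNeumannAlgebra H} {y : H →L[ℂ] H} (hy : y ∈ M) :
    ∃ u ∈ M, u * star u * u = u ∧ u * CFC.abs y = y ∧ (∀ a : H →L[ℂ] H, a * y = 0 → a * u = 0) ∧
      (∀ a : H →L[ℂ] H, y * a = 0 → u * a = 0) := by
  let W : Submodule ℂ (H × H) := LinearMap.range ((CFC.abs y).toLinearMap.prod y.toLinearMap)
  have hWm : ∀ w, w ∈ W ↔ ∃ ξ, (CFC.abs y ξ, y ξ) = w := fun w => Iff.rfl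
  have hA : ∀ c ∈ M.commutant, ∀ w ∈ W, (c w.1, c w.2) ∈ W := by
    rintro c hc w ⟨ξ, rfl⟩
    refine ⟨c ξ, ?_⟩
    refine Prod.ext ?_ ?_
    · exact (congrArg (fun f : H →L[ℂ] H => f ξ) (vn_abs_comm hy hc)).symm
    · exact (congrArg (fun f : H →L[ℂ] H => f ξ) (vn_comm hy hc)).symm
  have hB : ∀ w ∈ W, ‖w.1‖ = ‖w.2‖ := by
    rintro w ⟨ξ, rfl⟩
    exact norm_abs_apply y ξ
  obtain ⟨u, huM, h1, h2, h3, h4, h5⟩ := vn_isom M W hA hB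
  · refine ⟨u, huM, h1, ?_, ?_, ?_⟩
    · ext ξ; exact h2 _ ⟨ξ, rfl⟩
    · intro a ha
      apply h5
      rintro w ⟨ξ, rfl⟩
      exact congrArg (fun f : H →L[ℂ] H => f ξ) ha
    · intro a ha
      have := h4 (star a) ?_
      · have := congrArg star this
        simpa using this
      · rintro w ⟨ξ, rfl⟩
        exact congrArg (fun f : H →L[ℂ] H => f ξ) (abs_mul_zero ha)
end


section
variable {H : Type*} [NormedAddCommGroup H] [InnerProductSpace ℂ H] [CompleteSpace H]

lemma range_proj_of {M : VonNeumannAlgebra H} {y : H →L[ℂ] H} (hy : y ∈ M) :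
    ∃ e ∈ M, IsStarProjection e ∧ e * y = y ∧ ∀ a : H →L[ℂ] H, a * y = 0 → a * e = 0 := by
  obtain ⟨P, hP, hP1, hP2, hP3⟩ := vn_rangeProj M (LinearMap.range y.toLinearMap) (by
    rintro c hc _ ⟨ξ, rfl⟩
    exact ⟨c ξ, (congrArg (fun f : H →L[ℂ] H => f ξ) (vn_comm hy hc)).symm⟩)
  refine ⟨P, hP, hP1, ?_, ?_⟩
  · ext ξ; exact hP2 _ ⟨ξ, rfl⟩
  · intro a ha
    apply hP3
    rintro _ ⟨ξ, rfl⟩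
    exact congrArg (fun f : H →L[ℂ] H => f ξ) ha

lemma proj_comm_of {p e : H →L[ℂ] H} (hp : IsSelfAdjoint p) (he : IsStarProjection e)
    (h : (1 - e) * p * e = 0) : p * e = e * p := by
  have h1 : p * e = e * p * e := by
    rw [sub_mul, sub_mul, one_mul, sub_eq_zero] at h; exact h
  have h2 := congrArg star h1
  simp only [star_mul, hp.star_eq, he.isSelfAdjoint.star_eq] at h2
  exact h1.trans ((mul_assoc _ _ _).trans h2.symm)

lemma dyadic_step {M : VonNeumannAlgebra H} {a p : H →L[ℂ] H} (ha : a ∈ M) (h0 : 0 ≤ a)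
    (h1 : a ≤ 1) (hp : IsSelfAdjoint p) (hpa : p * a = a * p) :
    ∃ e ∈ M, IsStarProjection e ∧ p * e = e * p ∧ 0 ≤ 2 * a - e ∧ 2 * a - e ≤ 1 := by
  set h := 2 * a - 1 with hh
  have hhM : h ∈ M := sub_mem (by rw [two_mul]; exact add_mem ha ha) (one_mem M)
  have hsa : IsSelfAdjoint a := .of_nonneg h0
  have hhsa : IsSelfAdjoint h := by
    rw [hh, two_mul]; exact (hsa.add hsa).sub (.one _)
  have hcomm : ∀ c : H →L[ℂ] H, c * h = h * c → c * h⁺ = h⁺ * c := by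
    intro c hc
    rw [CFC.posPart_def]
    exact (Commute.cfcₙ_real (a := h) (b := c) hc.symm _).symm
  have hPM : h⁺ ∈ M := vn_mem_iff.2 fun c hc => hcomm c (vn_comm hhM hc)
  have hph : p * h = h * p := by rw [hh]; simp [mul_sub, sub_mul, two_mul, mul_add, add_mul, hpa]
  obtain ⟨e, heM, he, he1, he2⟩ := range_proj_of hPM
  have hP0 : 0 ≤ h⁺ := CFC.posPart_nonneg h
  have hN0 : 0 ≤ h⁻ := CFC.negPart_nonneg h
  have hPN : h⁺ - h⁻ = h := CFC.posPart_sub_negPart h hhsa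
  have hNe : h⁻ * e = 0 := he2 _ (CFC.negPart_mul_posPart h)
  have heN : e * h⁻ = 0 := by
    have := congrArg star hNe
    rwa [star_mul, he.isSelfAdjoint.star_eq, (IsSelfAdjoint.of_nonneg hN0).star_eq, star_zero] at this
  have hPe : h⁺ * e = h⁺ := by
    have := congrArg star he1
    rwa [star_mul, he.isSelfAdjoint.star_eq, (IsSelfAdjoint.of_nonneg hP0).star_eq] at this
  have hee : e * e = e := he.isIdempotentElem.eq
  refine ⟨e, heM, he, ?_, ?_, ?_⟩
  · apply proj_comm_of hp he
    apply he2
    rw [mul_assoc, hcomm p hph, ← mul_assoc, sub_mul, he1, one_mul, sub_self, zero_mul]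
  · have : 2 * a - e = (1 - e) * (a + a) * star (1 - e) + h⁺ := by
      have h2 : a + a = h + 1 := by rw [hh, two_mul]; abel
      have h3 : 2 * a - e = h + 1 - e := by rw [hh]; abel
      rw [h3, h2, star_sub, star_one, he.isSelfAdjoint.star_eq]
      clear_value h
      generalize h⁺ = P at *
      generalize h⁻ = N at *
      rw [← hPN]
      simp only [mul_sub, sub_mul, mul_add, add_mul, one_mul, mul_one, hPe, he1, heN, hNe, hee, zero_mul]
      abel
    rw [this]
    exact add_nonneg (star_right_conjugate_nonneg (add_nonneg h0 h0) _) hP0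
  · rw [← sub_nonneg]
    have : 1 - (2 * a - e) = e * ((1 - a) + (1 - a)) * star e + h⁻ := by
      have h2 : (1 - a) + (1 - a) = 1 - h := by rw [hh, two_mul]; abel
      have h3 : 1 - (2 * a - e) = e - h := by rw [hh]; abel
      rw [h3, h2, he.isSelfAdjoint.star_eq]
      clear_value h
      generalize h⁺ = P at *
      generalize h⁻ = N at *
      rw [← hPN]
      simp only [mul_sub, sub_mul, mul_add, add_mul, one_mul, mul_one, hPe, he1, heN, hNe, hee, zero_mul]
      abel
    rw [this]
    have h4 : 0 ≤ 1 - a := sub_nonneg.2 h1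
    exact add_nonneg (star_right_conjugate_nonneg (add_nonneg h4 h4) _) hN0

lemma dyadic_comm {M : VonNeumannAlgebra H} {b p : H →L[ℂ] H} (hp : IsSelfAdjoint p)
    (hb : ∀ e ∈ M, IsStarProjection e → p * e = e * p → b * e = e * b) (n : ℕ) :
    ∀ a ∈ M, 0 ≤ a → a ≤ 1 → p * a = a * p → 2 ^ n * ‖b * a - a * b‖ ≤ 2 * ‖b‖ := by
  induction n with
  | zero =>
    intro a _ h0 h1 _
    have : ‖a‖ ≤ 1 := (CStarAlgebra.norm_le_one_iff_of_nonneg a h0).2 h1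
    have h2 := norm_sub_le (b * a) (a * b)
    have h3 := norm_mul_le b a
    have h4 := norm_mul_le a b
    have := norm_nonneg b
    nlinarith
  | succ n ih =>
    intro a ha h0 h1 hpa
    obtain ⟨e, heM, he, hpe, h2, h3⟩ := dyadic_step ha h0 h1 hp hpa
    have h4 := ih (2 * a - e) (sub_mem (by rw [two_mul]; exact add_mem ha ha) heM) h2 h3 (by
      simp [mul_sub, sub_mul, two_mul, mul_add, add_mul, hpa, hpe])
    have h5 : b * (2 * a - e) - (2 * a - e) * b = (2 : ℂ) • (b * a - a * b) := by
      have := hb e heM he hpe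
      rw [two_smul]
      simp only [mul_sub, sub_mul, two_mul, mul_add, add_mul, this]
      abel
    rw [h5, norm_smul] at h4
    rw [pow_succ]
    simpa [mul_assoc] using h4

lemma dyadic_comm' {M : VonNeumannAlgebra H} {b p : H →L[ℂ] H} (hp : IsSelfAdjoint p)
    (hb : ∀ e ∈ M, IsStarProjection e → p * e = e * p → b * e = e * b)
    {a : H →L[ℂ] H} (ha : a ∈ M) (h0 : 0 ≤ a) (h1 : a ≤ 1) (hpa : p * a = a * p) :
    b * a = a * b := by
  rw [← sub_eq_zero, ← norm_eq_zero]
  by_contra hne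
  have hpos : 0 < ‖b * a - a * b‖ := lt_of_le_of_ne (norm_nonneg _) (Ne.symm hne)
  obtain ⟨n, hn⟩ := pow_unbounded_of_one_lt (2 * ‖b‖ / ‖b * a - a * b‖) (one_lt_two)
  rw [div_lt_iff₀ hpos] at hn
  exact absurd (dyadic_comm hp hb n a ha h0 h1 hpa) (not_le.2 hn)

lemma dyadic_comm_sa {M : VonNeumannAlgebra H} {b p : H →L[ℂ] H} (hp : IsSelfAdjoint p)
    (hb : ∀ e ∈ M, IsStarProjection e → p * e = e * p → b * e = e * b)
    {s : H →L[ℂ] H} (hs : s ∈ M) (hsa : IsSelfAdjoint s) (hps : p * s = s * p) :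
    b * s = s * b := by
  set t : ℝ := ‖s‖ + 1 with ht
  have htpos : 0 < t := by positivity
  set a : H →L[ℂ] H := (((2 * t)⁻¹ : ℝ) : ℂ) • (s + (t : ℂ) • (1 : H →L[ℂ] H)) with ha
  have hs1 : -algebraMap ℝ (H →L[ℂ] H) ‖s‖ ≤ s := hsa.neg_algebraMap_norm_le_self
  have hs2 : s ≤ algebraMap ℝ (H →L[ℂ] H) ‖s‖ := hsa.le_algebraMap_norm_self
  have hmono : algebraMap ℝ (H →L[ℂ] H) ‖s‖ ≤ algebraMap ℝ (H →L[ℂ] H) t :=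
    algebraMap_mono _ (by linarith)
  have e1 : a = ((2 * t)⁻¹ : ℝ) • (s + algebraMap ℝ (H →L[ℂ] H) t) := by
    rw [ha, Algebra.algebraMap_eq_smul_one, Complex.coe_smul, Complex.coe_smul]
  have ha0 : 0 ≤ a := by
    rw [e1]
    refine smul_nonneg (by positivity) ?_
    have := (neg_le_neg hmono).trans hs1
    exact neg_le_iff_add_nonneg.1 this
  have ha1 : a ≤ 1 := by
    have : (1 : H →L[ℂ] H) = ((2 * t)⁻¹ : ℝ) • (algebraMap ℝ (H →L[ℂ] H) t + algebraMap ℝ (H →L[ℂ] H) t) := by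
      rw [← map_add, Algebra.algebraMap_eq_smul_one, smul_smul, ← two_mul, inv_mul_cancel₀ (by positivity), one_smul]
    rw [e1, this]
    refine smul_le_smul_of_nonneg_left ?_ (by positivity)
    gcongr
    exact hs2.trans hmono
  have haM : a ∈ M := vn_smul_mem _ (add_mem hs (vn_smul_mem _ (one_mem M)))
  have h := dyadic_comm' hp hb haM ha0 ha1 (by simp [ha, mul_add, add_mul, hps])
  have hne : (((2 * t)⁻¹ : ℝ) : ℂ) ≠ 0 := by
    norm_cast; positivity
  simp only [ha, mul_smul_comm, smul_mul_assoc] at h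
  have h' := smul_right_injective _ hne h
  simp [mul_add, add_mul] at h'
  exact h'

/-- abelian projections -/
def VAbel (M : VonNeumannAlgebra H) (p : H →L[ℂ] H) : Prop :=
  ∀ x ∈ M, ∀ y ∈ M, (p * x * p) * (p * y * p) = (p * y * p) * (p * x * p)

lemma vn_nonabel {M : VonNeumannAlgebra H} {p : H →L[ℂ] H} (hpM : p ∈ M) (hp : IsStarProjection p)
    (h : ¬ VAbel M p) : ∃ u ∈ M, u ≠ 0 ∧ u * star u * u = u ∧ p * u = u ∧ u * p = u ∧ u * u = 0 := by
  by_contra hcon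
  apply h
  have hpp : p * p = p := hp.isIdempotentElem.eq
  -- all corners vanish
  have key : ∀ e ∈ M, IsStarProjection e → p * e = e → e * p = e → ∀ b ∈ M, (p - e) * b * e = 0 := by
    intro e heM he h1 h2 b hb
    by_contra hne
    have hee : e * e = e := he.isIdempotentElem.eq
    obtain ⟨u, huM, hu1, hu2, hu3, hu4⟩ := vn_polar (y := (p - e) * b * e)
      (mul_mem (mul_mem (sub_mem hpM heM) hb) heM)
    have hl : (1 - (p - e)) * u = 0 := hu3 _ (by
      have : (1 - (p - e)) * (p - e) = 0 := by
        simp [mul_sub, sub_mul, hpp, h1, h2, hee]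
      rw [← mul_assoc, ← mul_assoc, this, zero_mul, zero_mul])
    have hr : u * (1 - e) = 0 := hu4 _ (by
      rw [mul_assoc, mul_sub, hee, mul_one, sub_self, mul_zero])
    have hl' : (p - e) * u = u := by
      rw [sub_mul, one_mul, sub_eq_zero] at hl; exact hl.symm
    have hr' : u * e = u := by
      rw [mul_sub, mul_one, sub_eq_zero] at hr; exact hr.symm
    refine hcon ⟨u, huM, ?_, hu1, ?_, ?_, ?_⟩
    · rintro rfl; rw [zero_mul] at hu2; exact hne hu2.symm
    · rw [← hl', ← mul_assoc, mul_sub, hpp, h1]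
    · rw [← hr', mul_assoc, h2]
    · calc u * u = (u * e) * ((p - e) * u) := by rw [hl', hr']
        _ = u * (e * (p - e)) * u := by simp only [mul_assoc]
        _ = 0 := by rw [mul_sub, h2, hee, sub_self, mul_zero, zero_mul]
  have key2 : ∀ b ∈ M, ∀ e ∈ M, IsStarProjection e → p * e = e * p → 
      (p * b * p) * e = e * (p * b * p) := by
    intro b hb e heM he hpe
    have hee : e * e = e := he.isIdempotentElem.eq
    obtain ⟨f, hf⟩ : ∃ f, f = p * e := ⟨_, rfl⟩
    have hfM : f ∈ M := hf ▸ mul_mem hpM heM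
    have hfp : IsStarProjection f := ⟨by
      change f * f = f
      rw [hf, mul_assoc, ← mul_assoc e, ← hpe, mul_assoc p e e, hee, ← mul_assoc, hpp],
      by change star f = f
         rw [hf, star_mul, hp.isSelfAdjoint.star_eq, he.isSelfAdjoint.star_eq, hpe]⟩
    have h1 : p * f = f := by rw [hf, ← mul_assoc, hpp]
    have h2 : f * p = f := by rw [hf, mul_assoc, ← hpe, ← mul_assoc, hpp]
    have k1 := key f hfM hfp h1 h2 b hb
    have k2 := congrArg star (key f hfM hfp h1 h2 (star b) (star_mem hb))
    simp only [star_mul, star_sub, star_star, hp.isSelfAdjoint.star_eq, hfp.isSelfAdjoint.star_eq, star_zero] at k2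
    have k3 : p * b * f = f * b * f := by
      rw [sub_mul, sub_mul, sub_eq_zero] at k1; exact k1
    have k4 : f * b * p = f * b * f := by
      rw [← mul_assoc, mul_sub, sub_eq_zero] at k2; exact k2
    rw [mul_assoc, ← hf, k3, ← k4, ← mul_assoc, ← mul_assoc, ← hpe, hf]
  intro x hx y hy
  have comm_sa : ∀ s ∈ M, IsSelfAdjoint s → (p * x * p) * (p * s * p) = (p * s * p) * (p * x * p) := by
    intro s hs hsa
    refine dyadic_comm_sa hp.isSelfAdjoint (key2 x hx) (mul_mem (mul_mem hpM hs) hpM) ?_ ?_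
    · change star (p * s * p) = _
      simp only [star_mul, hp.isSelfAdjoint.star_eq, hsa.star_eq, mul_assoc]
    · simp only [← mul_assoc, hpp]
      simp only [mul_assoc, hpp]
  have h1 := comm_sa (y + star y) (add_mem hy (star_mem hy)) (IsSelfAdjoint.add_star_self y)
  have h2 := comm_sa (Complex.I • (y - star y)) (vn_smul_mem _ (sub_mem hy (star_mem hy))) (by
    change star _ = _
    rw [star_smul, star_sub, star_star]
    simp [smul_sub]
    abel)
  simp only [mul_smul_comm, smul_mul_assoc] at h2
  have h2' := smul_right_injective _ Complex.I_ne_zero h2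
  simp only [mul_add, add_mul, mul_sub, sub_mul] at h1 h2'
  have h3 : (2 : ℂ) • ((p * x * p) * (p * y * p)) = (2 : ℂ) • ((p * y * p) * (p * x * p)) := by
    have := congrArg₂ (· + ·) h1 h2'
    rw [two_smul, two_smul]
    simpa using this
  exact smul_right_injective _ two_ne_zero h3
end


section
variable {H : Type*} [NormedAddCommGroup H] [InnerProductSpace ℂ H] [CompleteSpace H]

/-- column bound -/
def ColB (M : VonNeumannAlgebra H) (C : ℝ) : Prop :=
  ∀ (n : ℕ) (e : H →L[ℂ] H) (v : Fin n → H →L[ℂ] H), IsStarProjection e → e ≠ 0 →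
    (∀ i, v i ∈ M) → (∀ i j, star (v i) * v j = if i = j then e else 0) → √n ≤ C

lemma pisom_proj {u : H →L[ℂ] H} (hu : u * star u * u = u) : IsStarProjection (star u * u) := by
  refine ⟨?_, ?_⟩
  · change star u * u * (star u * u) = star u * u
    rw [mul_assoc, ← mul_assoc u, hu]
  · change star (star u * u) = _
    rw [star_mul, star_star]

lemma proj_ne {u : H →L[ℂ] H} (hu : u ≠ 0) : star u * u ≠ 0 := by
  intro h; exact hu (CStarRing.star_mul_self_eq_zero_iff u |>.1 h)

lemma cols_noabel (M : VonNeumannAlgebra H) (n : ℕ) : ∀ p ∈ M, IsStarProjection p → p ≠ 0 →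
    (∀ e ∈ M, IsStarProjection e → p * e = e → VAbel M e → e = 0) →
    ∃ (e : H →L[ℂ] H) (v : Fin (n + 1) → H →L[ℂ] H), IsStarProjection e ∧ e ≠ 0 ∧
      (∀ i, v i ∈ M) ∧ (∀ i, p * v i = v i) ∧ ∀ i j, star (v i) * v j = if i = j then e else 0 := by
  induction n with
  | zero =>
    intro p hpM hp hp0 _
    refine ⟨p, fun _ => p, hp, hp0, fun _ => hpM, fun _ => hp.isIdempotentElem.eq, ?_⟩
    intro i j
    rw [if_pos (Fin.ext (by omega) : i = j), hp.isSelfAdjoint.star_eq, hp.isIdempotentElem.eq]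
  | succ n ih =>
    intro p hpM hp hp0 hno
    have hnab : ¬ VAbel M p := fun hab => hp0 (hno p hpM hp hp.isIdempotentElem.eq hab)
    obtain ⟨u, huM, hu0, hu1, hu2, hu3, hu4⟩ := vn_nonabel hpM hp hnab
    have he' := pisom_proj hu1
    have hpe' : p * (star u * u) = star u * u := by
      have := congrArg star hu3
      rw [star_mul, hp.isSelfAdjoint.star_eq] at this
      rw [← mul_assoc, this]
    obtain ⟨e, v, he, he0, hvM, hv1, hv2⟩ := ih (star u * u) (mul_mem (star_mem huM) huM) he'
      (proj_ne hu0) (fun f hfM hf hf1 hab => hno f hfM hf (by rw [← hf1, ← mul_assoc, hpe']) hab)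
    have hz : star u * (star u * u) = 0 := by
      rw [← mul_assoc, ← star_mul, hu4, star_zero, zero_mul]
    have hzv : ∀ i, star u * v i = 0 := by
      intro i; rw [← hv1 i, ← mul_assoc, hz, zero_mul]
    have hzv' : ∀ i, star (v i) * u = 0 := by
      intro i
      have := congrArg star (hzv i)
      rwa [star_mul, star_star, star_zero] at this
    refine ⟨e, Fin.cons (u * v 0) v, he, he0, ?_, ?_, ?_⟩
    · intro i; refine Fin.cases ?_ ?_ i
      · exact mul_mem huM (hvM 0)
      · intro i; exact hvM i
    · intro i; refine Fin.cases ?_ ?_ i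
      · rw [Fin.cons_zero, ← mul_assoc, hu2]
      · intro i; rw [Fin.cons_succ, ← hv1 i, ← mul_assoc, hpe']
    · intro i j
      refine Fin.cases ?_ ?_ i
      · refine Fin.cases ?_ ?_ j
        · rw [Fin.cons_zero, if_pos rfl, star_mul, mul_assoc, ← mul_assoc (star u), hv1, hv2, if_pos rfl]
        · intro j
          rw [Fin.cons_zero, Fin.cons_succ, star_mul, mul_assoc, hzv, mul_zero, if_neg (Fin.succ_ne_zero j).symm]
      · intro i
        refine Fin.cases ?_ ?_ j
        · rw [Fin.cons_zero, Fin.cons_succ, ← mul_assoc, hzv', zero_mul, if_neg (Fin.succ_ne_zero i)]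
        · intro j
          rw [Fin.cons_succ, Fin.cons_succ, hv2]
          simp [Fin.succ_inj]

lemma exists_nat_sqrt (C : ℝ) : ∃ n : ℕ, C < √((n + 1 : ℕ) : ℝ) := by
  obtain ⟨n, hn⟩ := exists_nat_gt (C ^ 2)
  refine ⟨n, Real.lt_sqrt_of_sq_lt (hn.trans ?_)⟩
  push_cast; linarith

lemma exists_abel {M : VonNeumannAlgebra H} {C : ℝ} (hC : ColB M C) {p : H →L[ℂ] H} (hpM : p ∈ M)
    (hp : IsStarProjection p) (hp0 : p ≠ 0) :
    ∃ e ∈ M, IsStarProjection e ∧ p * e = e ∧ VAbel M e ∧ e ≠ 0 := by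
  by_contra hcon
  obtain ⟨n, hn⟩ := exists_nat_sqrt C
  obtain ⟨e, v, he, he0, hvM, -, hv⟩ := cols_noabel M n p hpM hp hp0 (by
    intro e heM he h1 h2
    by_contra h3
    exact hcon ⟨e, heM, he, h1, h2, h3⟩)
  exact absurd (hC _ e v he he0 hvM hv) (not_le.2 hn)

/-- domination -/
def VDom (M : VonNeumannAlgebra H) (p q : H →L[ℂ] H) : Prop :=
  ∀ y ∈ M, q * y = y → (∀ m ∈ M, p * m * y = 0) → y = 0

lemma sp_star_mul {p e : H →L[ℂ] H} (hp : IsStarProjection p) (he : IsStarProjection e)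
    (h : p * e = e) : e * p = e := by
  have := congrArg star h
  rwa [star_mul, hp.isSelfAdjoint.star_eq, he.isSelfAdjoint.star_eq] at this

lemma exists_dom {M : VonNeumannAlgebra H} {C : ℝ} (hC : ColB M C) {q : H →L[ℂ] H} :
    ∃ p ∈ M, IsStarProjection p ∧ q * p = p ∧ VAbel M p ∧ VDom M p q := by
  let Q : Set (Set (H →L[ℂ] H)) := {F | (∀ e ∈ F, e ∈ M ∧ IsStarProjection e ∧ q * e = e ∧ VAbel M e) ∧
    ∀ e ∈ F, ∀ f ∈ F, e ≠ f → ∀ m ∈ M, e * m * f = 0}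
  obtain ⟨F, hF⟩ := zorn_subset Q (by
    intro c hc hch
    refine ⟨⋃₀ c, ⟨?_, ?_⟩, fun s hs => Set.subset_sUnion_of_mem hs⟩
    · rintro e ⟨s, hs, hes⟩
      exact (hc hs).1 e hes
    · rintro e ⟨s, hs, hes⟩ f ⟨t, ht, hft⟩ hne
      rcases hch.total hs ht with h | h
      · exact (hc ht).2 e (h hes) f hft hne
      · exact (hc hs).2 e hes f (h hft) hne)
  have hF1 := hF.prop.1
  have hF2 := hF.prop.2
  obtain ⟨p, hpM, hp, hp1, hp2⟩ := vn_rangeProj M (Submodule.span ℂ {ξ | ∃ e ∈ F, e ξ = ξ}) (by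
    intro c hc ξ hξ
    have : Submodule.span ℂ {ξ | ∃ e ∈ F, e ξ = ξ} ≤
        (Submodule.span ℂ {ξ | ∃ e ∈ F, e ξ = ξ}).comap c.toLinearMap := by
      rw [Submodule.span_le]
      rintro η ⟨e, he, heη⟩
      apply Submodule.subset_span
      refine ⟨e, he, ?_⟩
      have := congrArg (fun f : H →L[ℂ] H => f η) (vn_comm (hF1 e he).1 hc)
      change c (e η) = e (c η) at this
      change e (c η) = c η
      rw [← this, heη]
    exact this hξ)
  have hpe : ∀ e ∈ F, p * e = e := by
    intro e he
    ext ξ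
    refine hp1 _ (Submodule.subset_span ⟨e, he, ?_⟩)
    exact congrArg (fun f : H →L[ℂ] H => f ξ) (hF1 e he).2.1.isIdempotentElem.eq
  have hpa : ∀ a : H →L[ℂ] H, (∀ e ∈ F, a * e = 0) → a * p = 0 := by
    intro a ha
    apply hp2
    intro ξ hξ
    have : Submodule.span ℂ {ξ | ∃ e ∈ F, e ξ = ξ} ≤ LinearMap.ker a.toLinearMap := by
      rw [Submodule.span_le]
      rintro η ⟨e, he, heη⟩
      have := congrArg (fun f : H →L[ℂ] H => f η) (ha e he)
      change a (e η) = 0 at this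
      rw [heη] at this
      exact this
    exact this hξ
  have hpye : ∀ y ∈ M, ∀ e ∈ F, p * y * e = e * y * e := by
    intro y hy e he
    have hee := (hF1 e he).2.1.isIdempotentElem.eq
    have h1 : (e * star y - e * star y * e) * p = 0 := by
      apply hpa
      intro f hf
      by_cases hfe : e = f
      · subst hfe
        rw [sub_mul, mul_assoc _ e e, hee, sub_self]
      · have h2 := hF2 e he f hf hfe (star y) (star_mem hy)
        have h3 := hF2 e he f hf hfe 1 (one_mem M)
        rw [mul_one] at h3
        rw [sub_mul, h2, mul_assoc _ e f, h3, mul_zero, sub_zero]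
    rw [sub_mul, mul_assoc _ e p, sp_star_mul hp (hF1 e he).2.1 (hpe e he), sub_eq_zero] at h1
    have h2 := congrArg star h1
    simpa only [star_mul, star_star, hp.isSelfAdjoint.star_eq, (hF1 e he).2.1.isSelfAdjoint.star_eq, ← mul_assoc] using h2
  have hpp := hp.isIdempotentElem.eq
  refine ⟨p, hpM, hp, ?_, ?_, ?_⟩
  · have := hpa (1 - q) (fun e he => by rw [sub_mul, one_mul, (hF1 e he).2.2.1, sub_self])
    rw [sub_mul, one_mul, sub_eq_zero] at this
    exact this.symm
  · intro x hx y hy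
    have hgen : ∀ x ∈ M, ∀ y ∈ M, ∀ e ∈ F, p * x * p * (p * y * p) * e = e * x * e * (e * y * e) := by
      intro x hx y hy e he
      have hee := (hF1 e he).2.1.isIdempotentElem.eq
      calc p * x * p * (p * y * p) * e = p * x * (p * p * y * (p * e)) := by simp only [mul_assoc]
        _ = p * x * (e * y * e) := by rw [hpp, hpe e he, hpye y hy e he]
        _ = (p * x * e) * (y * e) := by simp only [mul_assoc]
        _ = e * x * (e * e) * (y * e) := by rw [hpye x hx e he, hee]
        _ = _ := by simp only [mul_assoc]
    have := hpa (p * x * p * (p * y * p) - p * y * p * (p * x * p)) (by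
      intro e he
      rw [sub_mul, hgen x hx y hy e he, hgen y hy x hx e he, (hF1 e he).2.2.2 x hx y hy, sub_self])
    rw [sub_mul, sub_eq_zero] at this
    simpa only [mul_assoc, hpp] using this
  · intro y hy hqy hpy
    by_contra hy0
    obtain ⟨g, hgM, hg, hg1, hg2⟩ := range_proj_of hy
    have hg0 : g ≠ 0 := by rintro rfl; rw [zero_mul] at hg1; exact hy0 hg1.symm
    obtain ⟨e, heM, he, hge, hab, he0⟩ := exists_abel hC hgM hg hg0
    have hqg : q * g = g := by
      have := hg2 (1 - q) (by rw [sub_mul, one_mul, hqy, sub_self])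
      rw [sub_mul, one_mul, sub_eq_zero] at this
      exact this.symm
    have hpg : ∀ m ∈ M, p * m * e = 0 := by
      intro m hm
      rw [← hge, ← mul_assoc, hg2 _ (hpy m hm), zero_mul]
    have hfe : ∀ f ∈ F, ∀ m ∈ M, f * m * e = 0 := by
      intro f hf m hm
      rw [← sp_star_mul hp (hF1 f hf).2.1 (hpe f hf), mul_assoc f, mul_assoc f, hpg m hm, mul_zero]
    have hef : ∀ f ∈ F, ∀ m ∈ M, e * m * f = 0 := by
      intro f hf m hm
      have := congrArg star (hfe f hf (star m) (star_mem hm))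
      simpa only [star_mul, star_star, star_zero, he.isSelfAdjoint.star_eq, (hF1 f hf).2.1.isSelfAdjoint.star_eq, ← mul_assoc] using this
    have hin : insert e F ∈ Q := by
      refine ⟨?_, ?_⟩
      · rintro f (rfl | hf)
        · exact ⟨heM, he, by rw [← hge, ← mul_assoc, hqg], hab⟩
        · exact hF1 f hf
      · rintro f (rfl | hf) f' (rfl | hf') hne
        · exact absurd rfl hne
        · exact hef f' hf'
        · exact hfe f hf
        · exact hF2 f hf f' hf' hne
    have heF : e ∈ F := hF.le_of_ge hin (Set.subset_insert e F) (Set.mem_insert e F)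
    have := hpg 1 (one_mem M)
    rw [mul_one, hpe e heF] at this
    exact he0 this
end


section
variable {H : Type*} [NormedAddCommGroup H] [InnerProductSpace ℂ H] [CompleteSpace H]

lemma norm_add_of_orth {a b c d : H} (h1 : inner ℂ a b = 0) (h2 : inner ℂ c d = 0)
    (h3 : ‖a‖ = ‖c‖) (h4 : ‖b‖ = ‖d‖) : ‖a + b‖ = ‖c + d‖ := by
  have e1 := norm_add_sq_eq_norm_sq_add_norm_sq_of_inner_eq_zero a b h1
  have e2 := norm_add_sq_eq_norm_sq_add_norm_sq_of_inner_eq_zero c d h2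
  rw [h3, h4, ← e2] at e1
  have := norm_nonneg (a + b)
  have := norm_nonneg (c + d)
  nlinarith

lemma max_isom_aux {M : VonNeumannAlgebra H} {p q : H →L[ℂ] H} (hpM : p ∈ M) (hqM : q ∈ M)
    (hp : IsStarProjection p) (hq : IsStarProjection q) :
    ∃ u ∈ M, p * u = u ∧ u * q = u ∧ u * star u * u = u ∧
      ∀ z ∈ M, (p - u * star u) * z * (q - star u * u) = 0 := by
  have hpp := hp.isIdempotentElem.eq
  have hqq := hq.isIdempotentElem.eq
  let Q : Set (Submodule ℂ (H × H)) := {W | (∀ c ∈ M.commutant, ∀ w ∈ W, (c w.1, c w.2) ∈ W) ∧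
    ∀ w ∈ W, ‖w.1‖ = ‖w.2‖ ∧ q w.1 = w.1 ∧ p w.2 = w.2}
  have hbot : (⊥ : Submodule ℂ (H × H)) ∈ Q := by
    refine ⟨?_, ?_⟩
    · intro c _ w hw
      rw [Submodule.mem_bot] at hw ⊢
      simp [hw]
    · intro w hw
      rw [Submodule.mem_bot] at hw
      simp [hw]
  obtain ⟨W, -, hW⟩ := zorn_le_nonempty₀ Q (by
    intro c hc hch y hy
    have hmem : ∀ w, w ∈ sSup c ↔ ∃ V ∈ c, w ∈ V := fun w =>
      Submodule.mem_sSup_of_directed ⟨y, hy⟩ hch.directedOn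
    refine ⟨sSup c, ⟨?_, ?_⟩, fun s hs => le_sSup hs⟩
    · intro d hd w hw
      obtain ⟨V, hV, hwV⟩ := (hmem w).1 hw
      exact (hmem _).2 ⟨V, hV, (hc hV).1 d hd w hwV⟩
    · intro w hw
      obtain ⟨V, hV, hwV⟩ := (hmem w).1 hw
      exact (hc hV).2 w hwV) ⊥ hbot
  have hW1 := hW.prop.1
  have hW2 := hW.prop.2
  obtain ⟨u, huM, hu, hu1, hu2, hu3, hu4⟩ := vn_isom M W hW1 (fun w hw => (hW2 w hw).1)
  have hpu : p * u = u := by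
    have := hu4 (1 - p) (fun w hw => by
      change w.2 - p w.2 = 0
      rw [(hW2 w hw).2.2, sub_self])
    rw [sub_mul, one_mul, sub_eq_zero] at this
    exact this.symm
  have hqu : q * star u = star u := by
    have := hu3 (1 - q) (fun w hw => by
      change w.1 - q w.1 = 0
      rw [(hW2 w hw).2.1, sub_self])
    rw [sub_mul, one_mul, sub_eq_zero] at this
    exact this.symm
  have huq : u * q = u := by
    have := congrArg star hqu
    rwa [star_mul, star_star, hq.isSelfAdjoint.star_eq] at this
  refine ⟨u, huM, hpu, huq, hu, ?_⟩
  intro z hz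
  have huu : u * (star u * u) = u := by rw [← mul_assoc, hu]
  obtain ⟨y, hy⟩ : ∃ y, y = (p - u * star u) * z * (q - star u * u) := ⟨_, rfl⟩
  rw [← hy]
  have hyM : y ∈ M := by
    rw [hy]
    exact mul_mem (mul_mem (sub_mem hpM (mul_mem huM (star_mem huM))) hz)
      (sub_mem hqM (mul_mem (star_mem huM) huM))
  have hyu : y * (star u * u) = 0 := by
    have : (q - star u * u) * (star u * u) = 0 := by
      rw [sub_mul, ← mul_assoc, hqu, mul_assoc, huu, sub_self]
    rw [hy, mul_assoc, this, mul_zero]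
  have hyq : y * (1 - q) = 0 := by
    have : (q - star u * u) * (1 - q) = 0 := by
      rw [sub_mul, mul_sub, mul_sub, hqq, mul_one, mul_one, mul_assoc, huq, sub_self, sub_self, sub_self]
    rw [hy, mul_assoc, this, mul_zero]
  have hpy : p * y = y := by
    rw [hy, ← mul_assoc, ← mul_assoc, mul_sub p, hpp, ← mul_assoc p, hpu]
  have huy : star u * y = 0 := by
    have : star u * (p - u * star u) = 0 := by
      have h1 := congrArg star hpu
      rw [star_mul, hp.isSelfAdjoint.star_eq] at h1
      have h2 := congrArg star huu
      simp only [star_mul, star_star] at h2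
      rw [mul_sub, h1, ← mul_assoc, h2, sub_self]
    rw [hy, ← mul_assoc, ← mul_assoc, this, zero_mul, zero_mul]
  obtain ⟨b, hb⟩ : ∃ b, b = CFC.abs y := ⟨_, rfl⟩
  have hbsa : star b = b := by
    rw [hb]; exact (IsSelfAdjoint.of_nonneg (CFC.abs_nonneg y)).star_eq
  have hbn : ∀ ξ, ‖b ξ‖ = ‖y ξ‖ := fun ξ => by rw [hb]; exact norm_abs_apply y ξ
  have hb0 : ∀ a : H →L[ℂ] H, y * a = 0 → b * a = 0 := by
    intro a ha
    ext ξ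
    have h1 : y (a ξ) = 0 := congrArg (fun f : H →L[ℂ] H => f ξ) ha
    change b (a ξ) = 0
    rw [← norm_eq_zero, hbn, h1, norm_zero]
  have hb0' : ∀ a : H →L[ℂ] H, star a = a → y * a = 0 → a * b = 0 := by
    intro a hsa ha
    have := congrArg star (hb0 a ha)
    rwa [star_mul, hbsa, hsa, star_zero] at this
  have hqb : q * b = b := by
    have := hb0' (1 - q) (by rw [star_sub, star_one, hq.isSelfAdjoint.star_eq]) hyq
    rw [sub_mul, one_mul, sub_eq_zero] at this
    exact this.symm
  have hub : star u * u * b = 0 := hb0' _ (by rw [star_mul, star_star]) hyu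
  let V : Submodule ℂ (H × H) := LinearMap.range (b.toLinearMap.prod y.toLinearMap)
  have hWV : W ⊔ V ∈ Q := by
    refine ⟨?_, ?_⟩
    · intro c hc w hw
      obtain ⟨w', hw', v, ⟨ξ, rfl⟩, rfl⟩ := Submodule.mem_sup.1 hw
      refine Submodule.mem_sup.2 ⟨_, hW1 c hc w' hw', (b (c ξ), y (c ξ)), ⟨c ξ, rfl⟩, ?_⟩
      have e1 : c (b ξ) = b (c ξ) := by
        have := vn_abs_comm hyM hc
        rw [← hb] at this
        exact congrArg (fun f : H →L[ℂ] H => f ξ) this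
      have e2 : c (y ξ) = y (c ξ) := congrArg (fun f : H →L[ℂ] H => f ξ) (vn_comm hyM hc)
      rw [← e1, ← e2]
      simp
    · intro w hw
      obtain ⟨w', hw', v, ⟨ξ, rfl⟩, rfl⟩ := Submodule.mem_sup.1 hw
      change ‖w'.1 + b ξ‖ = ‖w'.2 + y ξ‖ ∧ q (w'.1 + b ξ) = w'.1 + b ξ ∧ p (w'.2 + y ξ) = w'.2 + y ξ
      obtain ⟨h1, h2, h3⟩ := hW2 w' hw'
      have e1 : q (b ξ) = b ξ := congrArg (fun f : H →L[ℂ] H => f ξ) hqb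
      have e2 : p (y ξ) = y ξ := congrArg (fun f : H →L[ℂ] H => f ξ) hpy
      refine ⟨norm_add_of_orth ?_ ?_ h1 (hbn ξ), by rw [map_add, h2, e1], by rw [map_add, h3, e2]⟩
      · have e3 : (star u * u) (b ξ) = 0 := congrArg (fun f : H →L[ℂ] H => f ξ) hub
        rw [← hu2 w' hw', ← ContinuousLinearMap.adjoint_inner_right, ← ContinuousLinearMap.star_eq_adjoint,
          star_mul, star_star, e3, inner_zero_right]
      · have e3 : (star u) (y ξ) = 0 := congrArg (fun f : H →L[ℂ] H => f ξ) huy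
        rw [← hu1 w' hw', ← ContinuousLinearMap.adjoint_inner_right, ← ContinuousLinearMap.star_eq_adjoint,
          e3, inner_zero_right]
  have hVW : V ≤ W := le_sup_right.trans (hW.le_of_ge hWV le_sup_left)
  ext ξ
  have h1 := hu2 (b ξ, y ξ) (hVW ⟨ξ, rfl⟩)
  have h2 : (star u * u) (b ξ) = 0 := congrArg (fun f : H →L[ℂ] H => f ξ) hub
  change (star u * u) (b ξ) = b ξ at h1
  change y ξ = 0
  rw [← norm_eq_zero, ← hbn, ← h1, h2, norm_zero]

lemma max_isom {M : VonNeumannAlgebra H} {p q : H →L[ℂ] H} (hpM : p ∈ M) (hqM : q ∈ M)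
    (hp : IsStarProjection p) (hq : IsStarProjection q) (hpa : VAbel M p) (hqa : VAbel M q) :
    ∃ u ∈ M, p * u = u ∧ u * q = u ∧ u * star u * u = u ∧
      ∀ y ∈ M, p * y = y → y * q = y → u * star u * y = y ∧ y * (star u * u) = y := by
  have hpp := hp.isIdempotentElem.eq
  have hqq := hq.isIdempotentElem.eq
  obtain ⟨u, huM, hpu, huq, hu, hz⟩ := max_isom_aux hpM hqM hp hq
  have hup : star u * p = star u := by
    have h1 := congrArg star hpu
    rwa [star_mul, hp.isSelfAdjoint.star_eq] at h1
  have hqu : q * star u = star u := by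
    have h1 := congrArg star huq
    rwa [star_mul, hq.isSelfAdjoint.star_eq] at h1
  have hus : star u * u * star u = star u := by
    have h2 := congrArg star hu
    simpa only [star_mul, star_star, mul_assoc] using h2
  refine ⟨u, huM, hpu, huq, hu, ?_⟩
  intro y hy hpy hyq
  obtain ⟨r, hr⟩ : ∃ r, r = p - u * star u := ⟨_, rfl⟩
  obtain ⟨s, hs⟩ : ∃ s, s = q - star u * u := ⟨_, rfl⟩
  have hrM : r ∈ M := by rw [hr]; exact sub_mem hpM (mul_mem huM (star_mem huM))
  have hsM : s ∈ M := by rw [hs]; exact sub_mem hqM (mul_mem (star_mem huM) huM)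
  have hrp : p * r * p = r := by
    rw [hr, mul_sub, sub_mul, hpp, hpp, ← mul_assoc, hpu, mul_assoc, hup]
  have hsq : q * s * q = s := by
    rw [hs, mul_sub, sub_mul, hqq, hqq, ← mul_assoc, hqu, mul_assoc, huq]
  have h1 : r * y * s = 0 := by rw [hr, hs]; exact hz y hy
  have hur : star u * r = 0 := by rw [hr, mul_sub, hup, ← mul_assoc, hus, sub_self]
  have hus' : u * s = 0 := by rw [hs, mul_sub, huq, ← mul_assoc, hu, sub_self]
  have h2 : r * y = 0 := by
    have h3 := hpa r hrM (y * star u) (mul_mem hy (star_mem huM))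
    have h4 : p * (y * star u) * p = y * star u := by
      rw [← mul_assoc, hpy, mul_assoc, hup]
    rw [hrp, h4, mul_assoc, hur, mul_zero] at h3
    rw [hs, mul_sub, mul_assoc, hyq] at h1
    rw [sub_eq_zero.1 h1, mul_assoc, ← mul_assoc y, ← mul_assoc, h3, zero_mul]
  have h5 : u * star u * y = y := by
    rw [hr, sub_mul, hpy, sub_eq_zero] at h2; exact h2.symm
  refine ⟨h5, ?_⟩
  have h6 : y * s = 0 := by
    have h3 := hqa s hsM (star u * y) (mul_mem (star_mem huM) hy)
    have h4 : q * (star u * y) * q = star u * y := by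
      rw [← mul_assoc, hqu, mul_assoc, hyq]
    rw [hsq, h4] at h3
    rw [← h5, mul_assoc, mul_assoc, ← mul_assoc (star u), ← h3, ← mul_assoc, hus', zero_mul]
  rw [hs, mul_sub, hyq, sub_eq_zero] at h6
  exact h6.symm

lemma dom_seq {M : VonNeumannAlgebra H} {C : ℝ} (hC : ColB M C) (k : ℕ) :
    ∃ (P : Fin k → H →L[ℂ] H) (q : H →L[ℂ] H), q = 1 - ∑ i, P i ∧ q ∈ M ∧ IsStarProjection q ∧
      (∀ i, P i ∈ M ∧ IsStarProjection (P i) ∧ VAbel M (P i) ∧ VDom M (P i) q ∧ P i * q = 0) ∧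
      ∀ i j, i ≠ j → P i * P j = 0 := by
  induction k with
  | zero =>
    exact ⟨fun _ => 0, 1, by simp, one_mem M, .one _, fun i => i.elim0, fun i => i.elim0⟩
  | succ k ih =>
    obtain ⟨P, q, hq1, hqM, hq, hP, hPP⟩ := ih
    obtain ⟨p, hpM, hp, hqp, hab, hdom⟩ := exists_dom (q := q) hC
    have hpq := sp_star_mul hq hp hqp
    have hqq := hq.isIdempotentElem.eq
    have hpp := hp.isIdempotentElem.eq
    have hle : ∀ y, (q - p) * y = y → q * y = y := by
      intro y hy
      rw [← hy, ← mul_assoc, mul_sub, hqq, hqp]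
    have hPp : ∀ i, P i * p = 0 := by
      intro i; rw [← hqp, ← mul_assoc, (hP i).2.2.2.2, zero_mul]
    have hpP : ∀ i, p * P i = 0 := by
      intro i
      have := congrArg star (hPp i)
      rwa [star_mul, hp.isSelfAdjoint.star_eq, (hP i).2.1.isSelfAdjoint.star_eq, star_zero] at this
    refine ⟨Fin.cons p P, q - p, ?_, sub_mem hqM hpM, ⟨?_, ?_⟩, ?_, ?_⟩
    · rw [Fin.sum_cons, hq1]; abel
    · change (q - p) * (q - p) = q - p
      rw [mul_sub, sub_mul, sub_mul, hqq, hpq, hqp, hpp, sub_self, sub_zero]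
    · exact hq.isSelfAdjoint.sub hp.isSelfAdjoint
    · intro i
      refine Fin.cases ?_ ?_ i
      · refine ⟨hpM, hp, hab, fun y hy h1 h2 => hdom y hy (hle y h1) h2, ?_⟩
        rw [Fin.cons_zero, mul_sub, hpq, hpp, sub_self]
      · intro i
        obtain ⟨h1, h2, h3, h4, h5⟩ := hP i
        refine ⟨h1, h2, h3, fun y hy h1 h2 => h4 y hy (hle y h1) h2, ?_⟩
        rw [Fin.cons_succ, mul_sub, h5, hPp, sub_self]
    · intro i j
      refine Fin.cases ?_ ?_ i
      · refine Fin.cases ?_ ?_ j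
        · intro h; exact absurd rfl h
        · intro j _
          rw [Fin.cons_zero, Fin.cons_succ, hpP]
      · intro i
        refine Fin.cases ?_ ?_ j
        · intro _
          rw [Fin.cons_zero, Fin.cons_succ, hPp]
        · intro j h
          rw [Fin.cons_succ, Fin.cons_succ]
          exact hPP i j (fun h' => h (by rw [h']))

lemma abel_decomp {M : VonNeumannAlgebra H} {C : ℝ} (hC : ColB M C) :
    ∃ (k : ℕ) (P : Fin k → H →L[ℂ] H), ∑ i, P i = 1 ∧
      (∀ i, P i ∈ M ∧ IsStarProjection (P i) ∧ VAbel M (P i)) ∧ ∀ i j, i ≠ j → P i * P j = 0 := by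
  obtain ⟨n, hn⟩ := exists_nat_sqrt C
  obtain ⟨P, q, hq1, hqM, hq, hP, hPP⟩ := dom_seq hC (n + 1)
  refine ⟨n + 1, P, ?_, fun i => ⟨(hP i).1, (hP i).2.1, (hP i).2.2.1⟩, hPP⟩
  by_contra hne
  have hq0 : q ≠ 0 := by
    intro h; rw [h] at hq1; exact hne (sub_eq_zero.1 hq1.symm).symm
  obtain ⟨e, heM, he, hqe, hab, he0⟩ := exists_abel hC hqM hq hq0
  have hee := he.isIdempotentElem.eq
  have hex : ∀ i, ∃ u ∈ M, P i * u = u ∧ star u * u = e := by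
    intro i
    obtain ⟨h1, h2, h3, h4, h5⟩ := hP i
    obtain ⟨u, huM, hu1, hu2, hu3, hu4⟩ := max_isom h1 heM h2 he h3 hab
    refine ⟨u, huM, hu1, ?_⟩
    have heu : e * star u = star u := by
      have := congrArg star hu2
      rwa [star_mul, he.isSelfAdjoint.star_eq] at this
    have hz : e * (e - star u * u) = e - star u * u := by
      rw [mul_sub, hee, ← mul_assoc, heu]
    have := h4 (e - star u * u) (sub_mem heM (mul_mem (star_mem huM) huM)) (by
      rw [← hz, ← mul_assoc, hqe]) (by
      intro m hm
      have := (hu4 (P i * m * e) (mul_mem (mul_mem h1 hm) heM)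
        (by rw [← mul_assoc, ← mul_assoc, h2.isIdempotentElem.eq]) (by rw [mul_assoc, hee])).2
      rw [← hz, ← mul_assoc, mul_sub, this, mul_assoc _ e e, hee, sub_self])
    exact (sub_eq_zero.1 this).symm
  choose u huM hu1 hu2 using hex
  refine absurd (hC _ e u he he0 huM ?_) (not_le.2 hn)
  intro i j
  by_cases hij : i = j
  · rw [if_pos hij, hij, hu2]
  · rw [if_neg hij, ← hu1 i, ← hu1 j, star_mul, (hP i).2.1.isSelfAdjoint.star_eq, mul_assoc,
      ← mul_assoc (P i), hPP i j hij, zero_mul, mul_zero]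
end


lemma gel_iso (A : Type) [CommCStarAlgebra A] :
    ∃ (K : Type) (_ : TopologicalSpace K) (_ : CompactSpace K) (_ : T2Space K),
      Nonempty (A ≃L[ℂ] C(K, ℂ)) := by
  refine ⟨WeakDual.characterSpace ℂ A, inferInstance, inferInstance, inferInstance, ⟨?_⟩⟩
  exact LinearIsometryEquiv.toContinuousLinearEquiv
    { (gelfandStarTransform A).toAlgEquiv.toLinearEquiv with
      norm_map' := fun x => (gelfandTransform_isometry A).norm_map_of_map_zero (map_zero _) x }

@[reducible] def mkCommRing (A : Type) [i0 : NonUnitalNormedRing A] (r : A) (h1 : ∀ x, r * x = x)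
    (h2 : ∀ x, x * r = x) (hc : ∀ x y : A, x * y = y * x) : NormedCommRing A :=
  { i0 with
    one := r
    one_mul := h1
    mul_one := h2
    mul_comm := hc }

lemma gel_iso' (A : Type) [i0 : NonUnitalCStarAlgebra A] (r : A) (h1 : ∀ x, r * x = x)
    (h2 : ∀ x, x * r = x) (hc : ∀ x y : A, x * y = y * x) :
    ∃ (K : Type) (_ : TopologicalSpace K) (_ : CompactSpace K) (_ : T2Space K),
      Nonempty (A ≃L[ℂ] C(K, ℂ)) := by
  letI ia : NormedCommRing A := mkCommRing A r h1 h2 hc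
  letI ib : Algebra ℂ A := @Algebra.ofModule ℂ A _ _ i0.toModule (fun c x y => smul_mul_assoc c x y) (fun c x y => mul_smul_comm c x y)
  letI ic : NormedAlgebra ℂ A := { ib with norm_smul_le := i0.toNormedSpace.norm_smul_le }
  letI i1 : CommCStarAlgebra A :=
    { ia, ic, i0 with }
  exact gel_iso A

noncomputable def sigma_iso {ι : Type} [Fintype ι] (K : ι → Type) [∀ i, TopologicalSpace (K i)]
    [∀ i, CompactSpace (K i)] : (∀ i, C(K i, ℂ)) ≃L[ℂ] C(Σ i, K i, ℂ) :=
  LinearEquiv.toContinuousLinearEquivOfBounds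
    { toFun := fun f => ContinuousMap.sigma f
      invFun := fun g i => g.comp (ContinuousMap.sigmaMk i)
      map_add' := fun f g => by ext ⟨i, x⟩; rfl
      map_smul' := fun c f => by ext ⟨i, x⟩; rfl
      left_inv := fun f => by ext i x; rfl
      right_inv := fun g => by ext ⟨i, x⟩; rfl } 1 1
    (by
      intro f
      rw [one_mul]
      refine (ContinuousMap.norm_le _ (norm_nonneg f)).2 ?_
      rintro ⟨i, x⟩
      exact ((f i).norm_coe_le_norm x).trans (norm_le_pi_norm f i))
    (by
      intro g
      rw [one_mul]
      refine (pi_norm_le_iff_of_nonneg (norm_nonneg g)).2 ?_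
      intro i
      refine (ContinuousMap.norm_le _ (norm_nonneg g)).2 ?_
      intro x
      exact g.norm_coe_le_norm ⟨i, x⟩)

section
variable {H : Type} [NormedAddCommGroup H] [InnerProductSpace ℂ H] [CompleteSpace H]

/-- corner algebra -/
def vcorner (M : VonNeumannAlgebra H) (r : H →L[ℂ] H) (hr : IsStarProjection r) :
    NonUnitalStarSubalgebra ℂ (H →L[ℂ] H) where
  carrier := {x | x ∈ M ∧ r * x = x ∧ x * r = x}
  add_mem' := by
    rintro x y ⟨h1, h2, h3⟩ ⟨h4, h5, h6⟩
    exact ⟨add_mem h1 h4, by rw [mul_add, h2, h5], by rw [add_mul, h3, h6]⟩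
  zero_mem' := ⟨zero_mem M, mul_zero _, zero_mul _⟩
  mul_mem' := by
    rintro x y ⟨h1, h2, h3⟩ ⟨h4, h5, h6⟩
    exact ⟨mul_mem h1 h4, by rw [← mul_assoc, h2], by rw [mul_assoc, h6]⟩
  smul_mem' := by
    rintro c x ⟨h1, h2, h3⟩
    exact ⟨vn_smul_mem c h1, by rw [mul_smul_comm, h2], by rw [smul_mul_assoc, h3]⟩
  star_mem' := by
    rintro x ⟨h1, h2, h3⟩
    refine ⟨star_mem h1, ?_, ?_⟩
    · have := congrArg star h3
      rwa [star_mul, hr.isSelfAdjoint.star_eq] at this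
    · have := congrArg star h2
      rwa [star_mul, hr.isSelfAdjoint.star_eq] at this

lemma mem_vcorner {M : VonNeumannAlgebra H} {r : H →L[ℂ] H} {hr : IsStarProjection r}
    {x : H →L[ℂ] H} : x ∈ vcorner M r hr ↔ x ∈ M ∧ r * x = x ∧ x * r = x := Iff.rfl

lemma vcorner_closed (M : VonNeumannAlgebra H) (r : H →L[ℂ] H) (hr : IsStarProjection r) :
    IsClosed (vcorner M r hr : Set (H →L[ℂ] H)) := by
  have : (vcorner M r hr : Set (H →L[ℂ] H)) =
      {x | ∀ c ∈ M.commutant, c * x = x * c} ∩ ({x | r * x = x} ∩ {x | x * r = x}) := by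
    ext x
    simp only [SetLike.mem_coe, mem_vcorner, Set.mem_inter_iff, Set.mem_setOf_eq]
    rw [vn_mem_iff]
  rw [this]
  refine IsClosed.inter ?_ (IsClosed.inter ?_ ?_)
  · simp only [Set.setOf_forall]
    refine isClosed_iInter fun c => isClosed_iInter fun _ => ?_
    exact isClosed_eq (continuous_const.mul continuous_id) (continuous_id.mul continuous_const)
  · exact isClosed_eq (continuous_const.mul continuous_id) continuous_id
  · exact isClosed_eq (continuous_id.mul continuous_const) continuous_id

lemma vcorner_iso (M : VonNeumannAlgebra H) (r : H →L[ℂ] H) (hr : IsStarProjection r) (hrM : r ∈ M)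
    (hc : ∀ x ∈ vcorner M r hr, ∀ y ∈ vcorner M r hr, x * y = y * x) :
    ∃ (K : Type) (_ : TopologicalSpace K) (_ : CompactSpace K) (_ : T2Space K),
      Nonempty (vcorner M r hr ≃L[ℂ] C(K, ℂ)) := by
  haveI : IsClosed (vcorner M r hr : Set (H →L[ℂ] H)) := vcorner_closed M r hr
  exact gel_iso' (vcorner M r hr) ⟨r, hrM, hr.isIdempotentElem.eq, hr.isIdempotentElem.eq⟩
    (fun x => Subtype.ext x.2.2.1) (fun x => Subtype.ext x.2.2.2)
    (fun x y => Subtype.ext (hc x x.2 y y.2))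
end


section
variable {H : Type} [NormedAddCommGroup H] [InnerProductSpace ℂ H] [CompleteSpace H]

lemma block_iso (M : VonNeumannAlgebra H) {k : ℕ} (P : Fin k → H →L[ℂ] H) (hsum : ∑ i, P i = 1)
    (hPM : ∀ i, P i ∈ M) (hP : ∀ i, IsStarProjection (P i)) (hPP : ∀ i j, i ≠ j → P i * P j = 0)
    (u : Fin k × Fin k → H →L[ℂ] H) (huM : ∀ t, u t ∈ M) (hu1 : ∀ t, P t.1 * u t = u t)
    (hu2 : ∀ t, u t * P t.2 = u t)
    (hr : ∀ t, IsStarProjection (u t * star (u t)))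
    (hu4 : ∀ t, ∀ y ∈ M, P t.1 * y = y → y * P t.2 = y → u t * star (u t) * y = y ∧ y * (star (u t) * u t) = y) :
    Nonempty (M.toSubalgebra ≃L[ℂ] (∀ t : Fin k × Fin k, vcorner M (u t * star (u t)) (hr t))) := by
  have hPi : ∀ i, P i * P i = P i := fun i => (hP i).isIdempotentElem.eq
  have huP : ∀ t, P t.2 * star (u t) = star (u t) := by
    intro t
    have := congrArg star (hu2 t)
    rwa [star_mul, (hP _).isSelfAdjoint.star_eq] at this
  have hu3 : ∀ t, star (u t) * (u t * star (u t)) = star (u t) := by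
    intro t
    have := congrArg star (hu4 t (u t) (huM t) (hu1 t) (hu2 t)).1
    rwa [star_mul, star_mul, star_star] at this
  have hblock : ∀ t, ∀ x ∈ M, P t.1 * x * P t.2 * (star (u t) * u t) = P t.1 * x * P t.2 := by
    intro t x hx
    exact (hu4 t _ (mul_mem (mul_mem (hPM _) hx) (hPM _)) (by rw [← mul_assoc, ← mul_assoc, hPi])
      (by rw [mul_assoc, hPi])).2
  have hfmem : ∀ t, ∀ x ∈ M, P t.1 * x * star (u t) ∈ vcorner M (u t * star (u t)) (hr t) := by
    intro t x hx
    refine ⟨mul_mem (mul_mem (hPM _) hx) (star_mem (huM t)), ?_, ?_⟩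
    · have := (hu4 t (P t.1 * x * P t.2) (mul_mem (mul_mem (hPM _) hx) (hPM _)) (by rw [← mul_assoc, ← mul_assoc, hPi])
        (by rw [mul_assoc, hPi])).1
      have e : P t.1 * x * star (u t) = P t.1 * x * P t.2 * star (u t) := by
        rw [mul_assoc _ (P t.2), huP]
      rw [e, ← mul_assoc, this]
    · rw [mul_assoc, hu3]
  have hgmem : ∀ z : (∀ t : Fin k × Fin k, vcorner M (u t * star (u t)) (hr t)),
      ∑ t, (z t : H →L[ℂ] H) * u t ∈ M := fun z =>
    sum_mem fun t _ => mul_mem (z t).2.1 (huM t)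
  have hz1 : ∀ t (z : vcorner M (u t * star (u t)) (hr t)), P t.1 * (z : H →L[ℂ] H) = z := by
    intro t z
    rw [← z.2.2.1, ← mul_assoc, ← mul_assoc, hu1]
  let L : M.toSubalgebra ≃ₗ[ℂ] (∀ t : Fin k × Fin k, vcorner M (u t * star (u t)) (hr t)) :=
    { toFun := fun x t => ⟨P t.1 * (x : H →L[ℂ] H) * star (u t), hfmem t x x.2⟩
      invFun := fun z => ⟨∑ t, (z t : H →L[ℂ] H) * u t, hgmem z⟩
      map_add' := by
        intro x y; funext t; apply Subtype.ext
        change P t.1 * ((x : H →L[ℂ] H) + y) * star (u t) = P t.1 * (x : H →L[ℂ] H) * star (u t) + P t.1 * (y : H →L[ℂ] H) * star (u t)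
        rw [mul_add, add_mul]
      map_smul' := by
        intro c x; funext t; apply Subtype.ext
        change P t.1 * (c • (x : H →L[ℂ] H)) * star (u t) = c • (P t.1 * (x : H →L[ℂ] H) * star (u t))
        rw [mul_smul_comm, smul_mul_assoc]
      left_inv := by
        intro x; apply Subtype.ext
        change ∑ t : Fin k × Fin k, P t.1 * (x : H →L[ℂ] H) * star (u t) * u t = x
        have : ∀ t : Fin k × Fin k, P t.1 * (x : H →L[ℂ] H) * star (u t) * u t = P t.1 * (x : H →L[ℂ] H) * P t.2 := by
          intro t
          rw [← hblock t x x.2, ← huP t]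
          simp only [mul_assoc]
          rw [← mul_assoc (P t.2) (P t.2), hPi]
        simp only [this]
        rw [Fintype.sum_prod_type]
        simp only [← Finset.mul_sum, ← Finset.sum_mul, hsum, one_mul, mul_one]
      right_inv := by
        intro z; funext t; apply Subtype.ext
        change P t.1 * (∑ s, (z s : H →L[ℂ] H) * u s) * star (u t) = z t
        rw [Finset.mul_sum, Finset.sum_mul, Finset.sum_eq_single t]
        · rw [← mul_assoc, hz1, mul_assoc, (z t).2.2.2]
        · intro s _ hst
          have hzs := hz1 s (z s)
          generalize (z s : H →L[ℂ] H) = zz at hzs ⊢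
          rw [← hzs, ← hu2 s, ← huP t]
          by_cases h1 : t.1 = s.1
          · have h2 : s.2 ≠ t.2 := fun h => hst (Prod.ext h1.symm h)
            have := hPP _ _ h2
            calc _ = P t.1 * (P s.1 * zz * u s) * (P s.2 * P t.2) * star (u t) := by simp only [mul_assoc]
              _ = 0 := by rw [this, mul_zero, zero_mul]
          · have := hPP _ _ h1
            calc _ = (P t.1 * P s.1) * (zz * (u s * P s.2) * (P t.2 * star (u t))) := by simp only [mul_assoc]
              _ = 0 := by rw [this, zero_mul]
        · intro h; exact absurd (Finset.mem_univ t) h }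
  refine ⟨⟨L, ?_, ?_⟩⟩
  · refine continuous_pi fun t => Continuous.subtype_mk ?_ _
    exact (continuous_const.mul continuous_subtype_val).mul continuous_const
  · refine Continuous.subtype_mk ?_ _
    exact continuous_finsetSum _ fun t _ => (continuous_subtype_val.comp (continuous_apply t)).mul continuous_const

lemma final_iso {M : VonNeumannAlgebra H} {C : ℝ} (hC : ColB M C) :
    ∃ (K : Type) (_ : TopologicalSpace K) (_ : CompactSpace K) (_ : T2Space K),
      Nonempty (M.toSubalgebra ≃L[ℂ] C(K, ℂ)) := by
  obtain ⟨k, P, hsum, hP, hPP⟩ := abel_decomp hC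
  have hex : ∀ t : Fin k × Fin k, _ := fun t =>
    max_isom (hP t.1).1 (hP t.2).1 (hP t.1).2.1 (hP t.2).2.1 (hP t.1).2.2 (hP t.2).2.2
  choose u huM hu1 hu2 hu3 hu4 using hex
  have hr : ∀ t, IsStarProjection (u t * star (u t)) := by
    intro t
    have := pisom_proj (u := star (u t)) (by
      have := congrArg star (hu3 t)
      simpa only [star_mul, star_star, mul_assoc] using this)
    rwa [star_star] at this
  obtain ⟨B⟩ := block_iso M P hsum (fun i => (hP i).1) (fun i => (hP i).2.1) hPP u huM hu1 hu2 hr hu4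
  have hcor : ∀ t, ∃ (K : Type) (_ : TopologicalSpace K) (_ : CompactSpace K) (_ : T2Space K),
      Nonempty (vcorner M (u t * star (u t)) (hr t) ≃L[ℂ] C(K, ℂ)) := by
    intro t
    refine vcorner_iso M _ (hr t) (mul_mem (huM t) (star_mem (huM t))) ?_
    have hcomp : ∀ x ∈ vcorner M (u t * star (u t)) (hr t), P t.1 * x * P t.1 = x := by
      rintro x ⟨_, h1, h2⟩
      have h3 : star (u t) * P t.1 = star (u t) := by
        have := congrArg star (hu1 t)
        rwa [star_mul, (hP _).2.1.isSelfAdjoint.star_eq] at this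
      have h4 : P t.1 * x = x := by
        rw [← h1, ← mul_assoc, ← mul_assoc, hu1]
      have h5 : x * P t.1 = x := by
        rw [← h2, mul_assoc, mul_assoc, h3]
      rw [h4, h5]
    intro x hx y hy
    have := (hP t.1).2.2 x hx.1 y hy.1
    rwa [hcomp x hx, hcomp y hy] at this
  choose K hK1 hK2 hK3 hK4 using hcor
  refine ⟨Σ t, K t, inferInstance, inferInstance, inferInstance, ⟨?_⟩⟩
  exact (B.trans (ContinuousLinearEquiv.piCongrRight fun t => (hK4 t).some)).trans (sigma_iso K)
end

theorem stmt_0 {H : Type} [NormedAddCommGroup H] [InnerProductSpace ℂ H] [CompleteSpace H]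
    [TopologicalSpace.SeparableSpace H] (M : VonNeumannAlgebra H)
    (ℓ : M.toSubalgebra →L[ℂ] (H →L[ℂ] H))
    (hℓ : ∀ x : M.toSubalgebra, ℓ x = (x : H →L[ℂ] H))
    (lam : ℝ) (hlam : 1 ≤ lam) (h : HasLPProperty lam ℓ) :
    ∃ (K : Type) (_ : TopologicalSpace K) (_ : CompactSpace K) (_ : T2Space K),
      Nonempty (M.toSubalgebra ≃L[ℂ] C(K, ℂ)) := by
  obtain ⟨E, _, _, hE, S, T, hTS⟩ := h
  refine final_iso (C := 2 * (lam * ‖S‖ * ‖T‖)) ?_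
  intro n e v he he0 hv1 hv2
  let j : M.toSubalgebra →ₗᵢ[ℂ] (H →L[ℂ] H) := ⟨M.toSubalgebra.val.toLinearMap, fun x => rfl⟩
  refine col_bound hE S T j ?_ he he0 v (fun i => ⟨⟨v i, hv1 i⟩, rfl⟩) hv2
  intro x
  rw [← ContinuousLinearMap.comp_apply, hTS]
  exact hℓ x
end

section
/- Let H be a separable complex Hilbert space and let M be a von Neumann subalgebra of B(H), with ℓ : M → B(H) the inclusion map. If (M, ℓ) has the λ-Lindenstrauss–Pełczyński property for some λ ≥ 1, then for every λ' > 1 there exist a compact Hausdorff space K such that C(K, ℂ) is an L∞,λ'-space, and bounded linear operators S : M → C(K, ℂ) and T : C(K, ℂ) → B(H) with T ∘ S = ℓ; in particular (M, ℓ) has the λ'-Lindenstrauss–Pełczyński property for every λ' > 1, witnessed by an abelian C*-algebra E = C(K, ℂ). -/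
set_option synthInstance.maxHeartbeats 1000000
set_option maxHeartbeats 1000000

open Filter Topology

theorem aux_partition {K Y : Type*} [TopologicalSpace K] [CompactSpace K] [T2Space K]
    [TotallyDisconnectedSpace K] [PseudoMetricSpace Y] (Φ : K → Y) (hΦ : Continuous Φ)
    (ε : ℝ) (hε : 0 < ε) :
    ∃ (n : ℕ) (q : K → Fin n) (s : Fin n → K), Continuous q ∧ (∀ j, q (s j) = j) ∧
      ∀ x, dist (Φ (s (q x))) (Φ x) ≤ ε := by
  classical
  have h1 : ∀ x : K, ∃ V : Set K, IsClopen V ∧ x ∈ V ∧ V ⊆ Φ ⁻¹' Metric.ball (Φ x) (ε / 2) :=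
    fun x => compact_exists_isClopen_in_isOpen (Metric.isOpen_ball.preimage hΦ) (by simp [hε])
  choose U hU hxU hUb using h1
  obtain ⟨t, -, ht⟩ := isCompact_univ.elim_nhds_subcover U
    (fun x _ => (hU x).isOpen.mem_nhds (hxU x))
  let q0 : K → (t → Bool) := fun x i => decide (x ∈ U i)
  have hq0 : Continuous q0 := by
    refine continuous_pi fun i => ?_
    refine (continuous_bool_rng true).2 ?_
    have : (fun x => decide (x ∈ U i)) ⁻¹' {true} = U i := by ext; simp
    rw [this]; exact hU i
  let e := Fintype.equivFin (Set.range q0)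
  let q : K → Fin (Fintype.card (Set.range q0)) := fun x => e ⟨q0 x, x, rfl⟩
  have hs : ∀ j, ∃ x, q x = j := by
    intro j
    obtain ⟨x, hx⟩ := (e.symm j).2
    refine ⟨x, ?_⟩
    have : (⟨q0 x, x, rfl⟩ : Set.range q0) = e.symm j := Subtype.ext hx
    simp only [q, this, Equiv.apply_symm_apply]
  choose s hs using hs
  refine ⟨_, q, s, ?_, hs, ?_⟩
  · exact continuous_of_discreteTopology.comp (hq0.subtype_mk _)
  · intro x
    have hx : q0 (s (q x)) = q0 x := by
      have := e.injective (hs (q x))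
      exact congrArg Subtype.val this
    have hxt := ht (Set.mem_univ x)
    simp only [Set.mem_iUnion] at hxt
    obtain ⟨i, hi, hxi⟩ := hxt
    have h2 : s (q x) ∈ U i := by
      have := congrFun hx ⟨i, hi⟩
      simp only [q0, decide_eq_decide] at this
      exact this.2 hxi
    have h3 := hUb i hxi
    have h4 := hUb i h2
    simp only [Set.mem_preimage, Metric.mem_ball] at h3 h4
    have := dist_triangle_right (Φ (s (q x))) (Φ x) (Φ i)
    linarith

theorem aux_range {X : Type*} [NormedAddCommGroup X] [NormedSpace ℂ X] {n : ℕ}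
    (A : (Fin n → ℂ) →ₗ[ℂ] X) (a b : ℝ) (ha : 0 ≤ a) (hb : 0 ≤ b)
    (h1 : ∀ v, ‖A v‖ ≤ a * ‖v‖) (h2 : ∀ v, ‖v‖ ≤ b * ‖A v‖) :
    ∃ T : (LinearMap.range A) ≃L[ℂ] (Fin (Module.finrank ℂ (LinearMap.range A)) → ℂ),
        ‖(T : (LinearMap.range A) →L[ℂ] (Fin (Module.finrank ℂ (LinearMap.range A)) → ℂ))‖ *
          ‖(T.symm : (Fin (Module.finrank ℂ (LinearMap.range A)) → ℂ) →L[ℂ]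
            (LinearMap.range A))‖ ≤ b * a := by
  have hinj : Function.Injective A := by
    rw [injective_iff_map_eq_zero]
    intro v hv
    have := h2 v
    rw [hv] at this
    simpa using this
  have hn : n = Module.finrank ℂ (LinearMap.range A) := by
    rw [LinearMap.finrank_range_of_inj hinj]; simp
  generalize hG : LinearMap.range A = G at *
  subst hn
  let e := (LinearEquiv.ofInjective A hinj).trans (LinearEquiv.ofEq _ _ hG)
  haveI : FiniteDimensional ℂ G := e.finiteDimensional
  refine ⟨e.symm.toContinuousLinearEquiv, ?_⟩
  refine mul_le_mul ?_ ?_ (ContinuousLinearMap.opNorm_nonneg _) hb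
  · refine ContinuousLinearMap.opNorm_le_bound _ hb fun x => ?_
    obtain ⟨v, rfl⟩ := e.surjective x
    have : ‖e v‖ = ‖A v‖ := rfl
    rw [this]
    simpa using h2 v
  · refine ContinuousLinearMap.opNorm_le_bound _ ha fun v => ?_
    exact h1 v

theorem aux_linfty {K : Type*} [TopologicalSpace K] [CompactSpace K] [T2Space K]
    [TotallyDisconnectedSpace K] (hK : ¬ FiniteDimensional ℂ C(K, ℂ)) (lam : ℝ) (hlam : 1 < lam) :
    IsLinftySpace C(K, ℂ) lam := by
  refine ⟨hK, fun F hF => ?_⟩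
  obtain ⟨P, hP⟩ := Submodule.ClosedComplemented.of_finiteDimensional F
  set δ := (lam - 1) / (lam + 1) with hδ
  have hδ0 : 0 < δ := by rw [hδ]; apply div_pos <;> linarith
  have hδ1 : δ < 1 := by rw [hδ, div_lt_one] <;> linarith
  have hPp : 0 < ‖P‖ + 1 := by positivity
  let ev : K → (F →L[ℂ] ℂ) := fun x => (ContinuousMap.evalCLM ℂ x).comp F.subtypeL
  have hev : Continuous ev := by
    rw [continuous_clm_apply]
    intro f
    exact f.1.continuous
  obtain ⟨n, q, s, hq, hqs, hd⟩ := aux_partition ev hev (δ / (‖P‖ + 1)) (by positivity)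
  let ι : (Fin n → ℂ) →ₗ[ℂ] C(K, ℂ) :=
    { toFun := fun v => ⟨fun x => v (q x), continuous_of_discreteTopology.comp hq⟩
      map_add' := fun _ _ => rfl
      map_smul' := fun _ _ => rfl }
  have hι : ∀ v, ‖ι v‖ = ‖v‖ := by
    intro v
    apply le_antisymm
    · rw [ContinuousMap.norm_le _ (norm_nonneg _)]
      exact fun x => norm_le_pi_norm v (q x)
    · rw [pi_norm_le_iff_of_nonneg (norm_nonneg _)]
      intro j
      have := (ι v).norm_coe_le_norm (s j)
      simpa [ι, hqs] using this
  let r : F →ₗ[ℂ] (Fin n → ℂ) :=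
    { toFun := fun f j => f.1 (s j)
      map_add' := fun _ _ => rfl
      map_smul' := fun _ _ => rfl }
  let D : F →L[ℂ] C(K, ℂ) := LinearMap.mkContinuous (F.subtype - ι.comp r) (δ / (‖P‖ + 1)) (by
    intro f
    rw [ContinuousMap.norm_le _ (by positivity)]
    intro x
    have h1 := (ev (s (q x)) - ev x).le_opNorm f
    rw [← dist_eq_norm] at h1
    have h2 : ‖(ev (s (q x)) - ev x) f‖ = ‖(F.subtype - ι.comp r) f x‖ := by
      rw [← norm_neg]
      simp [ev, ι, r]
    rw [← h2]
    exact h1.trans (mul_le_mul_of_nonneg_right (hd x) (norm_nonneg _)))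
  have hD : ‖D.comp P‖ ≤ δ := by
    refine (D.opNorm_comp_le P).trans ?_
    have : ‖D‖ ≤ δ / (‖P‖ + 1) := LinearMap.mkContinuous_norm_le _ (by positivity) _
    calc ‖D‖ * ‖P‖ ≤ δ / (‖P‖ + 1) * (‖P‖ + 1) := by gcongr; linarith
      _ = δ := by field_simp
  let u := Units.oneSub (D.comp P) (hD.trans_lt hδ1)
  let V := ContinuousLinearEquiv.ofUnit u
  have hV : ∀ x, V x = x - D (P x) := fun x => rfl
  have hDb : ∀ x, ‖D (P x)‖ ≤ δ * ‖x‖ := fun x =>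
    ((D.comp P).le_opNorm x).trans (mul_le_mul_of_nonneg_right hD (norm_nonneg _))
  let A : (Fin n → ℂ) →ₗ[ℂ] C(K, ℂ) := (V.symm.toLinearEquiv : C(K, ℂ) →ₗ[ℂ] C(K, ℂ)).comp ι
  have hA : ∀ v, V (A v) = ι v := fun v => V.apply_symm_apply _
  have hA' : ∀ v, ι v = A v - D (P (A v)) := fun v => by rw [← hV, hA]
  refine ⟨LinearMap.range A, ?_, inferInstance, ?_⟩
  · intro f hf
    refine ⟨r ⟨f, hf⟩, ?_⟩
    apply V.injective
    rw [hA, hV, hP ⟨f, hf⟩]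
    change _ = f - (f - ι (r ⟨f, hf⟩))
    simp
  · obtain ⟨T, hT⟩ := aux_range A (1 / (1 - δ)) (1 + δ)
      (by apply div_nonneg <;> linarith) (by linarith)
      (fun v => by
        have h1 := norm_sub_norm_le (A v) (D (P (A v)))
        rw [← hA', hι] at h1
        have h2 := hDb (A v)
        rw [one_div, ← div_eq_inv_mul, le_div_iff₀ (by linarith)]
        linarith)
      (fun v => by
        have h1 := norm_sub_le (A v) (D (P (A v)))
        rw [← hA', hι] at h1
        have h2 := hDb (A v)
        linarith)
    refine ⟨T, hT.trans (le_of_eq ?_)⟩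
    have : lam + 1 ≠ 0 := by linarith
    have h2 : 1 - δ ≠ 0 := by linarith
    field_simp
    rw [hδ]
    field_simp
    ring

theorem aux_embed (E : Type) [NormedAddCommGroup E] [NormedSpace ℂ E] :
    ∃ (B : Type), Nonempty (E →ₗᵢ[ℂ] C(Ultrafilter B, ℂ)) := by
  let B0 : Set (WeakDual ℂ E) := WeakDual.toStrongDual ⁻¹' Metric.closedBall 0 1
  haveI : CompactSpace B0 := isCompact_iff_compactSpace.1 (WeakDual.isCompact_closedBall 0 1)
  let p : Ultrafilter B0 → B0 := Ultrafilter.extend id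
  have hp : Continuous p := continuous_ultrafilter_extend _
  let J : E →ₗ[ℂ] C(Ultrafilter B0, ℂ) :=
    { toFun := fun x => ⟨fun u => (p u).1 x,
        (WeakDual.eval_continuous x).comp (continuous_subtype_val.comp hp)⟩
      map_add' := fun x y => by ext u; exact map_add (p u).1 x y
      map_smul' := fun c x => by ext u; exact map_smul (p u).1 c x }
  refine ⟨B0, ⟨⟨J, fun x => le_antisymm ?_ ?_⟩⟩⟩
  · rw [ContinuousMap.norm_le _ (norm_nonneg _)]
    intro u
    have h1 : ‖WeakDual.toStrongDual (p u).1‖ ≤ 1 := by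
      have : WeakDual.toStrongDual (p u).1 ∈ Metric.closedBall 0 1 := (p u).2
      exact mem_closedBall_zero_iff.1 this
    exact (ContinuousLinearMap.le_of_opNorm_le (WeakDual.toStrongDual (p u).1) h1 x).trans
      (by simp)
  · obtain ⟨g, hg, hgx⟩ := exists_dual_vector'' ℂ x
    let b : B0 := ⟨StrongDual.toWeakDual g, by
      change g ∈ Metric.closedBall 0 1
      simpa using hg⟩
    have h1 := (J x).norm_coe_le_norm (pure b)
    have h2 : J x (pure b) = g x := by
      change (p (pure b)).1 x = g x
      have : p (pure b) = b := ultrafilter_extend_pure _ _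
      rw [this]; rfl
    rw [h2, hgx] at h1
    simpa using h1

theorem aux_local {E X Z : Type*} [NormedAddCommGroup E] [NormedSpace ℂ E]
    [NormedAddCommGroup X] [NormedSpace ℂ X] [NormedAddCommGroup Z] [NormedSpace ℂ Z]
    {lam : ℝ} (hE : IsLinftySpace E lam) (J : E →ₗᵢ[ℂ] X) (T : E →L[ℂ] Z)
    (s : Finset E) : ∃ Q : X →L[ℂ] Z, ‖Q‖ ≤ ‖T‖ * lam ∧ ∀ x ∈ s, Q (J x) = T x := by
  obtain ⟨G, hsG, hG, τ, hτ⟩ := hE.2 (Submodule.span ℂ (s : Set E))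
    (FiniteDimensional.span_finset ℂ s)
  let j : G →ₗᵢ[ℂ] X := J.comp G.subtypeₗᵢ
  let e := j.equivRange
  have h1 : ∀ i, ∃ g : X →L[ℂ] ℂ, (∀ x : G, g (j x) = τ x i) ∧
      ‖g‖ ≤ ‖(τ : G →L[ℂ] (Fin (Module.finrank ℂ G) → ℂ))‖ := by
    intro i
    let φ : (LinearMap.range j.toLinearMap) →L[ℂ] ℂ :=
      ((ContinuousLinearMap.proj i).comp (τ : G →L[ℂ] (Fin (Module.finrank ℂ G) → ℂ))).comp
        (e.symm.toContinuousLinearEquiv : (LinearMap.range j.toLinearMap) →L[ℂ] G)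
    obtain ⟨g, hg, hgn⟩ := exists_extension_norm_eq (LinearMap.range j.toLinearMap) φ
    refine ⟨g, fun x => ?_, ?_⟩
    · have := hg (e x)
      have h3 : φ (e x) = τ x i := by
        simp [φ]
      rw [h3] at this
      exact this
    · rw [hgn]
      refine ContinuousLinearMap.opNorm_le_bound _ (ContinuousLinearMap.opNorm_nonneg _) fun y => ?_
      have h4 := (τ : G →L[ℂ] (Fin (Module.finrank ℂ G) → ℂ)).le_opNorm (e.symm y)
      rw [LinearIsometryEquiv.norm_map] at h4
      exact (norm_le_pi_norm (τ (e.symm y)) i).trans h4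
  choose g hg hgn using h1
  let R : (Fin (Module.finrank ℂ G) → ℂ) →L[ℂ] G := τ.symm
  let W : X →L[ℂ] (Fin (Module.finrank ℂ G) → ℂ) := ContinuousLinearMap.pi g
  have hW : ‖W‖ ≤ ‖(τ : G →L[ℂ] (Fin (Module.finrank ℂ G) → ℂ))‖ :=
    ContinuousLinearMap.norm_pi_le_of_le hgn (ContinuousLinearMap.opNorm_nonneg _)
  refine ⟨T.comp (G.subtypeL.comp (R.comp W)), ?_, ?_⟩
  · refine ContinuousLinearMap.opNorm_le_bound _ ?_ fun x => ?_
    · exact mul_nonneg (norm_nonneg _) ((by positivity : (0:ℝ) ≤ _).trans hτ)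
    · have h5 : ‖R (W x)‖ ≤ lam * ‖x‖ := by
        calc ‖R (W x)‖ ≤ ‖R‖ * ‖W x‖ := R.le_opNorm _
          _ ≤ ‖R‖ * (‖(τ : G →L[ℂ] (Fin (Module.finrank ℂ G) → ℂ))‖ * ‖x‖) := by
              gcongr
              exact W.le_of_opNorm_le hW x
          _ = (‖(τ : G →L[ℂ] (Fin (Module.finrank ℂ G) → ℂ))‖ * ‖R‖) * ‖x‖ := by ring
          _ ≤ lam * ‖x‖ := by gcongr
      calc ‖T (R (W x) : E)‖ ≤ ‖T‖ * ‖R (W x)‖ := T.le_opNorm _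
        _ ≤ ‖T‖ * (lam * ‖x‖) := by gcongr
        _ = _ := by ring
  · intro x hx
    have hxG : x ∈ G := hsG (Submodule.subset_span hx)
    have h6 : W (J x) = τ ⟨x, hxG⟩ := by
      ext i
      exact hg i ⟨x, hxG⟩
    change T (R (W (J x)) : E) = T x
    rw [h6]
    simp [R]

theorem aux_weak {H ι : Type*} [NormedAddCommGroup H] [InnerProductSpace ℂ H] [CompleteSpace H]
    (U : Ultrafilter ι) (v : ι → H) (C : ℝ) (hv : ∀ i, ‖v i‖ ≤ C) :
    ∃ w : H, ‖w‖ ≤ C ∧ ∀ η, Tendsto (fun i => inner ℂ (v i) η) U (𝓝 (inner ℂ w η)) := by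
  let f : ι → WeakDual ℂ H := fun i => StrongDual.toWeakDual (InnerProductSpace.toDual ℂ H (v i))
  obtain ⟨φ, hφ, hle⟩ := (WeakDual.isCompact_closedBall (𝕜 := ℂ) (E := H) 0 C).ultrafilter_le_nhds
    (U.map f) (by
      rw [le_principal_iff]
      refine Filter.mem_map.2 (Filter.univ_mem' fun i => ?_)
      change InnerProductSpace.toDual ℂ H (v i) ∈ Metric.closedBall 0 C
      simpa using hv i)
  refine ⟨(InnerProductSpace.toDual ℂ H).symm (WeakDual.toStrongDual φ), ?_, fun η => ?_⟩
  · rw [LinearIsometryEquiv.norm_map]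
    exact mem_closedBall_zero_iff.1 hφ
  · rw [InnerProductSpace.toDual_symm_apply]
    have h1 : Tendsto f U (𝓝 φ) := hle
    exact ((WeakDual.eval_continuous η).tendsto φ).comp h1

theorem aux_limit {X H ι : Type*} [NormedAddCommGroup X] [NormedSpace ℂ X]
    [NormedAddCommGroup H] [InnerProductSpace ℂ H] [CompleteSpace H]
    (U : Ultrafilter ι) (Q : ι → X →L[ℂ] (H →L[ℂ] H)) (C : ℝ) (hQ : ∀ i, ‖Q i‖ ≤ C) :
    ∃ L : X →L[ℂ] (H →L[ℂ] H), ∀ x ξ η,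
      Tendsto (fun i => inner ℂ (Q i x ξ) η) U (𝓝 (inner ℂ (L x ξ) η)) := by
  have h0 : ∀ x ξ, ∃ w : H, ‖w‖ ≤ C * ‖x‖ * ‖ξ‖ ∧
      ∀ η, Tendsto (fun i => inner ℂ (Q i x ξ) η) U (𝓝 (inner ℂ w η)) := fun x ξ =>
    aux_weak U _ _ fun i => (Q i x).le_of_opNorm_le ((Q i).le_of_opNorm_le (hQ i) x) ξ
  choose w hw hlim using h0
  have huniq : ∀ x ξ z, (∀ η, Tendsto (fun i => inner ℂ (Q i x ξ) η) U (𝓝 (inner ℂ z η))) →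
      w x ξ = z := fun x ξ z hz =>
    ext_inner_right ℂ fun η => tendsto_nhds_unique (hlim x ξ η) (hz η)
  let L0 : X →ₗ[ℂ] H →ₗ[ℂ] H := LinearMap.mk₂ ℂ w
    (fun x y ξ => huniq _ _ _ fun η => by
      simpa [inner_add_left] using (hlim x ξ η).add (hlim y ξ η))
    (fun c x ξ => huniq _ _ _ fun η => by
      simpa [inner_smul_left, mul_comm] using (hlim x ξ η).const_mul ((starRingEnd ℂ) c))
    (fun x ξ ζ => huniq _ _ _ fun η => by
      simpa [inner_add_left] using (hlim x ξ η).add (hlim x ζ η))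
    (fun c x ξ => huniq _ _ _ fun η => by
      simpa [inner_smul_left, mul_comm] using (hlim x ξ η).const_mul ((starRingEnd ℂ) c))
  exact ⟨L0.mkContinuous₂ C hw, fun x ξ η => hlim x ξ η⟩

theorem stmt_1 {H : Type} [NormedAddCommGroup H] [InnerProductSpace ℂ H] [CompleteSpace H]
    [TopologicalSpace.SeparableSpace H] (M : VonNeumannAlgebra H)
    (ℓ : M.toSubalgebra →L[ℂ] (H →L[ℂ] H))
    (hℓ : ∀ x : M.toSubalgebra, ℓ x = (x : H →L[ℂ] H))
    (lam : ℝ) (hlam : 1 ≤ lam) (h : HasLPProperty lam ℓ) :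
    ∀ lam' : ℝ, 1 < lam' →
      ∃ (K : Type) (_ : TopologicalSpace K) (_ : CompactSpace K) (_ : T2Space K),
        IsLinftySpace C(K, ℂ) lam' ∧
        ∃ (S : M.toSubalgebra →L[ℂ] C(K, ℂ)) (T : C(K, ℂ) →L[ℂ] (H →L[ℂ] H)),
          T.comp S = ℓ := by
  classical
  intro lam' hlam'
  obtain ⟨E, _, _, hE, S, T, hTS⟩ := h
  obtain ⟨B, ⟨J⟩⟩ := aux_embed E
  refine ⟨Ultrafilter B, inferInstance, inferInstance, inferInstance,
    aux_linfty (fun hfd => hE.1 ?_) lam' hlam', ?_⟩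
  · exact FiniteDimensional.of_injective J.toLinearMap J.injective
  · choose Q hQ hQJ using aux_local hE J T
    obtain ⟨L, hL⟩ := aux_limit (Ultrafilter.of (atTop : Filter (Finset E))) Q _ hQ
    refine ⟨J.toContinuousLinearMap.comp S, L, ?_⟩
    have key : ∀ x, L (J x) = T x := by
      intro x
      ext ξ
      refine ext_inner_right ℂ fun η => tendsto_nhds_unique (hL (J x) ξ η) ?_
      refine tendsto_const_nhds.congr' ?_
      have h1 : ∀ᶠ s : Finset E in atTop, x ∈ s := by
        filter_upwards [eventually_ge_atTop ({x} : Finset E)] with s hs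
        exact hs (by simp)
      have h2 := (Ultrafilter.of_le (atTop : Filter (Finset E))) h1
      filter_upwards [h2] with s hs
      rw [hQJ s x hs]
    rw [← hTS]
    ext1 m
    exact key (S m)
end
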